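/- arXiv:1301.1813 — 7 statements merged into one kernel-verified Lean document; each statement's English description precedes it below -/
import Mathlib

section
/- Let F = α·φ(β/α) be an (α,β)-norm on an n-dimensional real vector space V with n > 1, with an α-orthogonal decomposition V = V₁ ⊕ V₂, dim V₁ = n − 1, V₁ = ker β when β ≠ 0, so that SO(V₁,α) ⊆ L₀(V,F). Then F is Euclidean if and only if dim L₀(V,F) > dim SO(V₁,α), where the dimension of these compact subgroups of GL(V) is their dimension as a Lie group (equivalently, their Hausdorff dimension as subsets of the normed space of endomorphisms of V). -/
noncomputable section

open Module Topology

/-- A symmetric positive definite bilinear form on a real vector space (an inner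
product). -/
def IsPosDefSymm {V : Type*} [AddCommGroup V] [Module ℝ V]
    (B : V →ₗ[ℝ] V →ₗ[ℝ] ℝ) : Prop :=
  (∀ x y, B x y = B y x) ∧ ∀ x, x ≠ 0 → 0 < B x x

/-- The norm `α` associated to the inner product `B`. -/
def alphaOf {V : Type*} [AddCommGroup V] [Module ℝ V]
    (B : V →ₗ[ℝ] V →ₗ[ℝ] ℝ) (y : V) : ℝ :=
  Real.sqrt (B y y)

/-- A Minkowski norm on a real vector space: continuous, nonnegative, positive and smooth
away from the origin, positively homogeneous, and strongly convex (the Hessian of `F²` at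
every nonzero point is positive definite). -/
structure IsMinkowskiNorm {V : Type*} [NormedAddCommGroup V] [NormedSpace ℝ V]
    (F : V → ℝ) : Prop where
  continuous : Continuous F
  nonneg : ∀ y, 0 ≤ F y
  pos : ∀ y, y ≠ 0 → 0 < F y
  smooth : ContDiffOn ℝ (⊤ : ℕ∞) F {(0 : V)}ᶜ
  homog : ∀ c : ℝ, 0 < c → ∀ y, F (c • y) = c * F y
  strongConvex : ∀ y, y ≠ 0 → ∀ w, w ≠ 0 →
    0 < iteratedFDeriv ℝ 2 (fun z => (F z) ^ 2) y ![w, w]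

/-- `F` is Euclidean: `F²` is given by an inner product. -/
def IsEuclideanNorm {V : Type*} [NormedAddCommGroup V] [NormedSpace ℝ V]
    (F : V → ℝ) : Prop :=
  ∃ B : V →ₗ[ℝ] V →ₗ[ℝ] ℝ, IsPosDefSymm B ∧ ∀ y, (F y) ^ 2 = B y y

/-- The closed interval of values of `β/α` (for `α` the norm of `B`). -/
def datumInterval {V : Type*} [NormedAddCommGroup V] [NormedSpace ℝ V]
    (B : V →ₗ[ℝ] V →ₗ[ℝ] ℝ) (β : V →ₗ[ℝ] ℝ) : Set ℝ :=
  closure {s | ∃ y, y ≠ 0 ∧ s = β y / alphaOf B y}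

/-- `(φ, B, β)` exhibits `F` as an `(α,β)`-norm `F = α·φ(β/α)`: `α` is the norm of the
inner product `B`, `β` is a linear form, and `φ` is a positive smooth function on the
closed interval of values of `β/α`. -/
def IsAlphaBetaDatum {V : Type*} [NormedAddCommGroup V] [NormedSpace ℝ V]
    (F : V → ℝ) (φ : ℝ → ℝ) (B : V →ₗ[ℝ] V →ₗ[ℝ] ℝ) (β : V →ₗ[ℝ] ℝ) : Prop :=
  IsPosDefSymm B ∧ ContDiffOn ℝ (⊤ : ℕ∞) φ (datumInterval B β) ∧
    (∀ s ∈ datumInterval B β, 0 < φ s) ∧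
    ∀ y, y ≠ 0 → F y = alphaOf B y * φ (β y / alphaOf B y)

/-- `F` is an `(α,β)`-norm. -/
def IsAlphaBetaNorm {V : Type*} [NormedAddCommGroup V] [NormedSpace ℝ V]
    (F : V → ℝ) : Prop :=
  IsMinkowskiNorm F ∧ ∃ φ B β, IsAlphaBetaDatum F φ B β

/-- A normalized datum of a non-Euclidean `(α,β)`-norm: `α(y) = F(y)` on `ker β`, and
`α(y) = β(y) = F(y)` for `y` in the `α`-orthogonal complement of `ker β` with
`β(y) > 0`. -/
def IsNormalizedDatum {V : Type*} [NormedAddCommGroup V] [NormedSpace ℝ V]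
    (F : V → ℝ) (φ : ℝ → ℝ) (B : V →ₗ[ℝ] V →ₗ[ℝ] ℝ) (β : V →ₗ[ℝ] ℝ) : Prop :=
  IsAlphaBetaDatum F φ B β ∧
    (∀ y, β y = 0 → alphaOf B y = F y) ∧
    ∀ y, (∀ x, β x = 0 → B y x = 0) → 0 < β y → alphaOf B y = β y ∧ β y = F y

/-- The group of linear isometries `L(V, F)`, as a subgroup of the units of the algebra of
continuous endomorphisms of `V`. -/
def linIso {V : Type*} [NormedAddCommGroup V] [NormedSpace ℝ V] (F : V → ℝ) :
    Subgroup (V →L[ℝ] V)ˣ where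
  carrier := {A | ∀ y, F ((A : V →L[ℝ] V) y) = F y}
  one_mem' := by intro y; simp
  mul_mem' := by
    intro a b ha hb y
    have h : ((a * b : (V →L[ℝ] V)ˣ) : V →L[ℝ] V) y
        = (a : V →L[ℝ] V) ((b : V →L[ℝ] V) y) := rfl
    rw [h, ha, hb]
  inv_mem' := by
    intro a ha y
    have h : (a : V →L[ℝ] V) (((a⁻¹ : (V →L[ℝ] V)ˣ) : V →L[ℝ] V) y) = y := by
      have h2 : ((a * a⁻¹ : (V →L[ℝ] V)ˣ) : V →L[ℝ] V) y = y := by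
        rw [mul_inv_cancel]; rfl
      exact h2
    calc F (((a⁻¹ : (V →L[ℝ] V)ˣ) : V →L[ℝ] V) y)
        = F ((a : V →L[ℝ] V) (((a⁻¹ : (V →L[ℝ] V)ˣ) : V →L[ℝ] V) y)) := (ha _).symm
      _ = F y := by rw [h]

/-- The identity component of a subgroup of `GL(V)` (with its subspace topology), as a set
of units of the algebra of continuous endomorphisms. -/
def idComp {V : Type*} [NormedAddCommGroup V] [NormedSpace ℝ V]
    (H : Subgroup (V →L[ℝ] V)ˣ) : Set (V →L[ℝ] V)ˣ :=
  Subtype.val '' connectedComponent (1 : H)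

/-- The group of linear maps preserving the inner-product norm `α = alphaOf B`, mapping
`V₁` onto itself and acting as the identity on `V₂`; its identity component is
`SO(V₁, α)`. -/
def soGroup {V : Type*} [NormedAddCommGroup V] [NormedSpace ℝ V]
    (B : V →ₗ[ℝ] V →ₗ[ℝ] ℝ) (V₁ V₂ : Submodule ℝ V) :
    Subgroup (V →L[ℝ] V)ˣ where
  carrier := {A | (∀ y, alphaOf B ((A : V →L[ℝ] V) y) = alphaOf B y) ∧
    (∀ x ∈ V₂, (A : V →L[ℝ] V) x = x) ∧
    Submodule.map ((A : V →L[ℝ] V) : V →ₗ[ℝ] V) V₁ = V₁}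
  one_mem' := by
    refine ⟨fun y => by simp, fun x _ => by simp, ?_⟩
    have : (((1 : (V →L[ℝ] V)ˣ) : V →L[ℝ] V) : V →ₗ[ℝ] V) = LinearMap.id := rfl
    rw [this, Submodule.map_id]
  mul_mem' := by
    intro a b ha hb
    refine ⟨fun y => ?_, fun x hx => ?_, ?_⟩
    · have h : ((a * b : (V →L[ℝ] V)ˣ) : V →L[ℝ] V) y
          = (a : V →L[ℝ] V) ((b : V →L[ℝ] V) y) := rfl
      rw [h, ha.1, hb.1]
    · have h : ((a * b : (V →L[ℝ] V)ˣ) : V →L[ℝ] V) x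
          = (a : V →L[ℝ] V) ((b : V →L[ℝ] V) x) := rfl
      rw [h, hb.2.1 x hx, ha.2.1 x hx]
    · have h : (((a * b : (V →L[ℝ] V)ˣ) : V →L[ℝ] V) : V →ₗ[ℝ] V)
          = (((a : V →L[ℝ] V) : V →ₗ[ℝ] V)).comp (((b : V →L[ℝ] V) : V →ₗ[ℝ] V)) := rfl
      rw [h, Submodule.map_comp, hb.2.2, ha.2.2]
  inv_mem' := by
    intro a ha
    have hmul : ∀ y : V, (a : V →L[ℝ] V) (((a⁻¹ : (V →L[ℝ] V)ˣ) : V →L[ℝ] V) y) = y := by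
      intro y
      have h2 : ((a * a⁻¹ : (V →L[ℝ] V)ˣ) : V →L[ℝ] V) y = y := by
        rw [mul_inv_cancel]; rfl
      exact h2
    refine ⟨fun y => ?_, fun x hx => ?_, ?_⟩
    · conv_rhs => rw [← hmul y]
      exact (ha.1 _).symm
    · have h1 := ha.2.1 _ hx
      have h3 : ((a⁻¹ : (V →L[ℝ] V)ˣ) : V →L[ℝ] V) ((a : V →L[ℝ] V) x)
          = ((a⁻¹ * a : (V →L[ℝ] V)ˣ) : V →L[ℝ] V) x := rfl
      conv_lhs => rw [show (x : V) = (a : V →L[ℝ] V) x from h1.symm]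
      rw [h3, inv_mul_cancel]; rfl
    · have hcomp : (((a⁻¹ : (V →L[ℝ] V)ˣ) : V →L[ℝ] V) : V →ₗ[ℝ] V).comp
          (((a : V →L[ℝ] V) : V →ₗ[ℝ] V)) = LinearMap.id := by
        have h3 : ((a⁻¹ * a : (V →L[ℝ] V)ˣ) : V →L[ℝ] V) = (1 : V →L[ℝ] V) := by
          rw [inv_mul_cancel]; rfl
        ext y
        have h4 : ((a⁻¹ : (V →L[ℝ] V)ˣ) : V →L[ℝ] V) ((a : V →L[ℝ] V) y) = y := by
          have h5 : ((a⁻¹ * a : (V →L[ℝ] V)ˣ) : V →L[ℝ] V) y = y := by rw [h3]; rfl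
          exact h5
        simpa using h4
      conv_lhs => rw [← ha.2.2]
      rw [← Submodule.map_comp, hcomp, Submodule.map_id]

section LinearIsometryDimension

variable {V : Type*} [NormedAddCommGroup V] [NormedSpace ℝ V]

lemma exists_forall_mul_norm_le [FiniteDimensional ℝ V] [Nontrivial V] {F : V → ℝ}
    (hc : Continuous F) (hpos : ∀ y, y ≠ 0 → 0 < F y)
    (hhom : ∀ c : ℝ, 0 < c → ∀ y, F (c • y) = c * F y) :
    ∃ c : ℝ, 0 < c ∧ ∀ y, y ≠ 0 → c * ‖y‖ ≤ F y := by
  obtain ⟨x, hx, hmin⟩ := (isCompact_sphere (0 : V) 1).exists_isMinOn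
    (NormedSpace.sphere_nonempty.2 zero_le_one) hc.continuousOn
  have hx0 : x ≠ 0 := by
    rintro rfl
    simp at hx
  refine ⟨F x, hpos x hx0, fun y hy => ?_⟩
  have hy' : 0 < ‖y‖ := norm_pos_iff.2 hy
  have h1 : F x ≤ F (‖y‖⁻¹ • y) := hmin (by simp [norm_smul, hy'.ne'])
  rw [hhom _ (inv_pos.2 hy')] at h1
  calc F x * ‖y‖ ≤ (‖y‖⁻¹ * F y) * ‖y‖ := by gcongr
    _ = F y := by field_simp

lemma hasCompactSupport_max_one_sub [FiniteDimensional ℝ V] [Nontrivial V] {F : V → ℝ}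
    (hc : Continuous F) (hpos : ∀ y, y ≠ 0 → 0 < F y)
    (hhom : ∀ c : ℝ, 0 < c → ∀ y, F (c • y) = c * F y) :
    HasCompactSupport fun y => max 0 (1 - F y) := by
  obtain ⟨c, hc0, hle⟩ := exists_forall_mul_norm_le hc hpos hhom
  refine HasCompactSupport.intro (isCompact_closedBall (0 : V) c⁻¹) fun y hy => ?_
  have hy1 : c⁻¹ < ‖y‖ := by simpa using hy
  have hy0 : y ≠ 0 := by
    rintro rfl
    have := inv_pos.2 hc0
    simp at hy1
    linarith
  have h2 : 1 < c * ‖y‖ := by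
    rw [inv_lt_iff_one_lt_mul₀ hc0] at hy1
    linarith
  exact max_eq_left (by linarith [hle y hy0])

lemma unit_apply_inv_apply (g : (V →L[ℝ] V)ˣ) (y : V) :
    (g : V →L[ℝ] V) (((g⁻¹ : (V →L[ℝ] V)ˣ) : V →L[ℝ] V) y) = y := by
  rw [← mul_apply_eq_comp, Units.mul_inv, one_apply_eq_self]

lemma unit_inv_apply_apply (g : (V →L[ℝ] V)ˣ) (y : V) :
    ((g⁻¹ : (V →L[ℝ] V)ˣ) : V →L[ℝ] V) ((g : V →L[ℝ] V) y) = y := by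
  rw [← mul_apply_eq_comp, Units.inv_mul, one_apply_eq_self]

open MeasureTheory in
lemma integral_comp_unit [FiniteDimensional ℝ V] [MeasurableSpace V] [BorelSpace V]
    (μ : Measure V) [μ.IsAddHaarMeasure] {E : Type*} [NormedAddCommGroup E] [NormedSpace ℝ E]
    (g : (V →L[ℝ] V)ˣ) (f : V → E) :
    ∫ y, f ((g : V →L[ℝ] V) y) ∂μ =
      |(LinearMap.det ((g : V →L[ℝ] V) : V →ₗ[ℝ] V))⁻¹| • ∫ y, f y ∂μ := by
  let L : V ≃L[ℝ] V := ContinuousLinearEquiv.unitsEquiv ℝ V g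
  have hdet : LinearMap.det ((g : V →L[ℝ] V) : V →ₗ[ℝ] V) ≠ 0 :=
    (LinearEquiv.isUnit_det' L.toLinearEquiv).ne_zero
  have hmap := Measure.map_linearMap_addHaar_eq_smul_addHaar μ hdet
  have hemb : MeasurableEmbedding fun y => (g : V →L[ℝ] V) y :=
    L.toHomeomorph.measurableEmbedding
  rw [← hemb.integral_map]
  have hmap' : Measure.map (fun y => (g : V →L[ℝ] V) y) μ =
      ENNReal.ofReal |(LinearMap.det ((g : V →L[ℝ] V) : V →ₗ[ℝ] V))⁻¹| • μ := hmap
  rw [hmap', integral_smul_measure, ENNReal.toReal_ofReal (abs_nonneg _)]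

open MeasureTheory in
/-- A continuous positive homogeneous function on a finite-dimensional space has an inner
product which is invariant under all its linear isometries: the dual of the second moment
form of the unit ball. -/
lemma exists_invariant_form [FiniteDimensional ℝ V] [Nontrivial V] {F : V → ℝ}
    (hc : Continuous F) (hpos : ∀ y, y ≠ 0 → 0 < F y)
    (hhom : ∀ c : ℝ, 0 < c → ∀ y, F (c • y) = c * F y) :
    ∃ Q : V →ₗ[ℝ] V →ₗ[ℝ] ℝ, IsPosDefSymm Q ∧
      ∀ g ∈ linIso F, ∀ x y, Q ((g : V →L[ℝ] V) x) ((g : V →L[ℝ] V) y) = Q x y := by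
  let : MeasurableSpace V := borel V
  have : BorelSpace V := ⟨rfl⟩
  let μ : Measure V := Measure.addHaar
  have hF0 : F 0 = 0 := by
    have := hhom 2 two_pos 0
    rw [smul_zero] at this
    linarith
  set w : V → ℝ := fun y => max 0 (1 - F y) with hw
  have hwc : Continuous w := continuous_const.max (continuous_const.sub hc)
  have hws : HasCompactSupport w := hasCompactSupport_max_one_sub hc hpos hhom
  have hw0 : w 0 = 1 := by simp [hw, hF0]
  have hξc (ξ : V →ₗ[ℝ] ℝ) : Continuous ξ := ξ.continuous_of_finiteDimensional
  have hintegrable (ξ : V →ₗ[ℝ] ℝ) : Integrable (fun y => (w y * ξ y) • y) μ :=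
    Continuous.integrable_of_hasCompactSupport ((hwc.mul (hξc ξ)).smul continuous_id)
      ((hws.mul_right).smul_right)
  let C : (V →ₗ[ℝ] ℝ) →ₗ[ℝ] V :=
    { toFun := fun ξ => ∫ y, (w y * ξ y) • y ∂μ
      map_add' := fun ξ η => by
        rw [← integral_add (hintegrable ξ) (hintegrable η)]
        congr 1 with y
        rw [LinearMap.add_apply, mul_add, add_smul]
      map_smul' := fun c ξ => by
        rw [RingHom.id_apply, ← integral_smul]
        congr 1 with y
        rw [LinearMap.smul_apply, smul_smul, smul_eq_mul]
        ring_nf }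
  have hC (ξ : V →ₗ[ℝ] ℝ) : C ξ = ∫ y, (w y * ξ y) • y ∂μ := rfl
  have hpair (ξ η : V →ₗ[ℝ] ℝ) : η (C ξ) = ∫ y, w y * ξ y * η y ∂μ := by
    have := (LinearMap.toContinuousLinearMap η).integral_comp_comm (hintegrable ξ)
    simp only [LinearMap.coe_toContinuousLinearMap', map_smul, smul_eq_mul] at this
    rw [hC, this]
  have hCpos (ξ : V →ₗ[ℝ] ℝ) (hξ : ξ ≠ 0) : 0 < ξ (C ξ) := by
    rw [hpair]
    obtain ⟨v, hv⟩ : ∃ v, ξ v ≠ 0 := by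
      by_contra! h
      exact hξ (LinearMap.ext h)
    have hev : ∀ᶠ t : ℝ in 𝓝[>] 0, 0 < w (t • v) := by
      have hcont : Continuous fun t : ℝ => w (t • v) :=
        hwc.comp (continuous_id.smul continuous_const)
      have h1 : 0 < w ((0 : ℝ) • v) := by rw [zero_smul, hw0]; exact one_pos
      exact (hcont.continuousAt.eventually (lt_mem_nhds h1)).filter_mono nhdsWithin_le_nhds
    obtain ⟨t, ht, ht0⟩ := (hev.and self_mem_nhdsWithin).exists
    have ht0 : 0 < t := ht0
    refine Continuous.integral_pos_of_hasCompactSupport_nonneg_nonzero (x := t • v)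
      ((hwc.mul (hξc ξ)).mul (hξc ξ)) (hws.mul_right.mul_right) (fun y => ?_) ?_
    · change 0 ≤ w y * ξ y * ξ y
      rw [mul_assoc]
      exact mul_nonneg (le_max_left _ _) (mul_self_nonneg _)
    · rw [map_smul, smul_eq_mul]
      exact mul_ne_zero (mul_ne_zero ht.ne' (mul_ne_zero ht0.ne' hv)) (mul_ne_zero ht0.ne' hv)
  have hCinj : Function.Injective C := by
    rw [← LinearMap.ker_eq_bot, LinearMap.ker_eq_bot']
    intro ξ h
    by_contra hξ
    have := hCpos ξ hξ
    rw [h, map_zero] at this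
    exact lt_irrefl _ this
  let e : (V →ₗ[ℝ] ℝ) ≃ₗ[ℝ] V := LinearEquiv.ofInjectiveOfFinrankEq C hCinj
    (Subspace.dual_finrank_eq (K := ℝ) (V := V))
  have he (ξ : V →ₗ[ℝ] ℝ) : e ξ = C ξ := rfl
  refine ⟨e.symm.toLinearMap, ⟨fun x y => ?_, fun x hx => ?_⟩, fun g hg x y => ?_⟩
  · obtain ⟨ξ, rfl⟩ := e.surjective x
    obtain ⟨η, rfl⟩ := e.surjective y
    simp only [LinearEquiv.coe_coe, LinearEquiv.symm_apply_apply]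
    rw [he, he, hpair, hpair]
    congr 1 with y
    ring
  · obtain ⟨ξ, rfl⟩ := e.surjective x
    simp only [LinearEquiv.coe_coe, LinearEquiv.symm_apply_apply]
    exact hCpos ξ (by rintro rfl; simp at hx)
  · have hgF : ∀ y, F ((g : V →L[ℝ] V) y) = F y := hg
    have hwg (y : V) : w ((g : V →L[ℝ] V) y) = w y := by simp only [hw, hgF]
    have hw_pos : 0 < ∫ y, w y ∂μ :=
      hwc.integral_pos_of_hasCompactSupport_nonneg_nonzero (x := 0) hws
        (fun y => le_max_left _ _) (by rw [hw0]; exact one_ne_zero)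
    have hd : |(LinearMap.det ((g : V →L[ℝ] V) : V →ₗ[ℝ] V))⁻¹| = 1 := by
      have := integral_comp_unit μ g w
      simp only [hwg, smul_eq_mul] at this
      exact (mul_eq_right₀ hw_pos.ne').1 this.symm
    obtain ⟨ξ, rfl⟩ := e.surjective x
    let η : V →ₗ[ℝ] ℝ := ξ ∘ₗ (((g⁻¹ : (V →L[ℝ] V)ˣ) : V →L[ℝ] V) : V →ₗ[ℝ] V)
    have hη (y : V) : η ((g : V →L[ℝ] V) y) = ξ y := congrArg ξ (unit_inv_apply_apply g y)
    have hgC : (g : V →L[ℝ] V) (e ξ) = e η := by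
      have h1 := integral_comp_unit μ g fun y => (w y * η y) • y
      rw [hd, one_smul] at h1
      simp only [hwg, hη] at h1
      rw [he, he, hC, hC, ← h1, ← ContinuousLinearMap.integral_comp_comm _ (hintegrable ξ)]
      simp only [map_smul]
    rw [hgC]
    simp only [LinearEquiv.coe_coe, LinearEquiv.symm_apply_apply]
    exact hη y

lemma IsPosDefSymm.eq_zero {B : V →ₗ[ℝ] V →ₗ[ℝ] ℝ} (hB : IsPosDefSymm B) {x : V}
    (h : B x x = 0) : x = 0 := by
  by_contra hx
  exact (hB.2 x hx).ne' h

lemma IsPosDefSymm.nonneg {B : V →ₗ[ℝ] V →ₗ[ℝ] ℝ} (hB : IsPosDefSymm B) (x : V) :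
    0 ≤ B x x := by
  rcases eq_or_ne x 0 with rfl | hx
  · simp
  · exact (hB.2 x hx).le

lemma IsPosDefSymm.apply_add_self {B : V →ₗ[ℝ] V →ₗ[ℝ] ℝ} (hB : IsPosDefSymm B) (x y : V) :
    B (x + y) (x + y) = B x x + 2 * B x y + B y y := by
  simp only [map_add, LinearMap.add_apply, hB.1 y x]
  ring

lemma IsPosDefSymm.apply_sub_self {B : V →ₗ[ℝ] V →ₗ[ℝ] ℝ} (hB : IsPosDefSymm B) (x y : V) :
    B (x - y) (x - y) = B x x - 2 * B x y + B y y := by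
  simp only [map_sub, LinearMap.sub_apply, hB.1 y x]
  ring

lemma IsPosDefSymm.injective_of_preserves {B : V →ₗ[ℝ] V →ₗ[ℝ] ℝ} (hB : IsPosDefSymm B)
    {f : V →ₗ[ℝ] V} (hf : ∀ x, B (f x) (f x) = B x x) : Function.Injective f := by
  rw [← LinearMap.ker_eq_bot, LinearMap.ker_eq_bot']
  intro x hx
  apply hB.eq_zero
  rw [← hf, hx]
  simp

lemma exists_unit_of_injective [FiniteDimensional ℝ V] (f : V →ₗ[ℝ] V)
    (hf : Function.Injective f) : ∃ a : (V →L[ℝ] V)ˣ, ∀ y, (a : V →L[ℝ] V) y = f y :=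
  ⟨(ContinuousLinearEquiv.unitsEquiv ℝ V).symm
    (LinearEquiv.ofInjectiveEndo f hf).toContinuousLinearEquiv, fun _ => rfl⟩

lemma mem_soGroup [FiniteDimensional ℝ V] {B : V →ₗ[ℝ] V →ₗ[ℝ] ℝ} {V₁ V₂ : Submodule ℝ V}
    {a : (V →L[ℝ] V)ˣ}
    (ha : ∀ y, B ((a : V →L[ℝ] V) y) ((a : V →L[ℝ] V) y) = B y y)
    (ha₂ : ∀ x ∈ V₂, (a : V →L[ℝ] V) x = x)
    (ha₁ : ∀ x ∈ V₁, (a : V →L[ℝ] V) x ∈ V₁) : a ∈ soGroup B V₁ V₂ := by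
  refine ⟨fun y => by simp only [alphaOf, ha], ha₂, ?_⟩
  refine Submodule.eq_of_le_of_finrank_eq ?_ ?_
  · rintro _ ⟨x, hx, rfl⟩
    exact ha₁ x hx
  · exact LinearEquiv.finrank_map_eq (ContinuousLinearEquiv.unitsEquiv ℝ V a).toLinearEquiv V₁

lemma IsPosDefSymm.apply_of_mem_soGroup {B : V →ₗ[ℝ] V →ₗ[ℝ] ℝ} (hB : IsPosDefSymm B)
    {V₁ V₂ : Submodule ℝ V} {a : (V →L[ℝ] V)ˣ} (ha : a ∈ soGroup B V₁ V₂) (y : V) :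
    B ((a : V →L[ℝ] V) y) ((a : V →L[ℝ] V) y) = B y y :=
  (Real.sqrt_inj (hB.nonneg _) (hB.nonneg _)).1 (ha.1 y)

lemma apply_mem_of_mem_soGroup {B : V →ₗ[ℝ] V →ₗ[ℝ] ℝ}
    {V₁ V₂ : Submodule ℝ V} {a : (V →L[ℝ] V)ˣ} (ha : a ∈ soGroup B V₁ V₂) {x : V}
    (hx : x ∈ V₁) : (a : V →L[ℝ] V) x ∈ V₁ := by
  rw [← ha.2.2]
  exact ⟨x, hx, rfl⟩

/-- Reflections act transitively on spheres. -/
lemma exists_mem_soGroup_apply_eq [FiniteDimensional ℝ V] {B : V →ₗ[ℝ] V →ₗ[ℝ] ℝ}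
    (hB : IsPosDefSymm B) {V₁ V₂ : Submodule ℝ V}
    (horth : ∀ x ∈ V₁, ∀ y ∈ V₂, B x y = 0) {x y : V} (hx : x ∈ V₁) (hy : y ∈ V₁)
    (hxy : B x x = B y y) : ∃ k ∈ soGroup B V₁ V₂, (k : V →L[ℝ] V) x = y := by
  rcases eq_or_ne x y with rfl | hne
  · exact ⟨1, one_mem _, rfl⟩
  set u := x - y with hu
  have hu0 : 0 < B u u := hB.2 u (sub_ne_zero.2 hne)
  have huV : u ∈ V₁ := V₁.sub_mem hx hy
  let f : V →ₗ[ℝ] V := LinearMap.id - ((2 / B u u) • B.flip u).smulRight u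
  have hf (v : V) : f v = v - (2 / B u u * B v u) • u := rfl
  have hpres (v : V) : B (f v) (f v) = B v v := by
    rw [hf, hB.apply_sub_self]
    simp only [map_smul, LinearMap.smul_apply, smul_eq_mul]
    field_simp
    ring
  obtain ⟨k, hk⟩ := exists_unit_of_injective f (hB.injective_of_preserves hpres)
  refine ⟨k, mem_soGroup (fun v => by rw [hk, hpres]) (fun v hv => ?_) (fun v hv => ?_), ?_⟩
  · rw [hk, hf, hB.1 v, horth u huV v hv, mul_zero, zero_smul, sub_zero]
  · rw [hk, hf]
    exact V₁.sub_mem hv (V₁.smul_mem _ huV)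
  · have huu : B u u = 2 * B x u := by
      rw [hu, hB.apply_sub_self, map_sub, hxy]
      ring
    have : 2 / B u u * B x u = 1 := by
      rw [div_mul_eq_mul_div, ← huu, div_self hu0.ne']
    rw [hk, hf, this, one_smul, hu, sub_sub_cancel]

lemma soGroup_le_linIso {F : V → ℝ} {φ : ℝ → ℝ} {B : V →ₗ[ℝ] V →ₗ[ℝ] ℝ} {β : V →ₗ[ℝ] ℝ}
    (hF : ∀ y, y ≠ 0 → F y = alphaOf B y * φ (β y / alphaOf B y))
    {V₁ V₂ : Submodule ℝ V} (hcompl : IsCompl V₁ V₂) (hβ : ∀ x ∈ V₁, β x = 0) :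
    soGroup B V₁ V₂ ≤ linIso F := by
  intro k hk y
  rcases eq_or_ne y 0 with rfl | hy
  · rw [map_zero]
  have hky : (k : V →L[ℝ] V) y ≠ 0 := fun h => hy (by
    rw [← unit_inv_apply_apply k y, h, map_zero])
  have hβk : β ((k : V →L[ℝ] V) y) = β y := by
    obtain ⟨y₁, y₂, hy₁, hy₂, rfl⟩ :=
    Submodule.codisjoint_iff_exists_add_eq.1 hcompl.codisjoint y
    rw [map_add, map_add, map_add, hk.2.1 y₂ hy₂, hβ _ hy₁,
      hβ _ (apply_mem_of_mem_soGroup hk hy₁)]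
  rw [hF _ hky, hF _ hy, hβk, hk.1]

/-- The form `Q` is invariant under the full orthogonal group of `V₁`. -/
def IsSoInvariant (Q B : V →ₗ[ℝ] V →ₗ[ℝ] ℝ) (V₁ V₂ : Submodule ℝ V) : Prop :=
  ∀ k ∈ soGroup B V₁ V₂, ∀ x y, Q ((k : V →L[ℝ] V) x) ((k : V →L[ℝ] V) y) = Q x y

section Invariant

variable [FiniteDimensional ℝ V] {B Q : V →ₗ[ℝ] V →ₗ[ℝ] ℝ} {V₁ V₂ : Submodule ℝ V}

lemma IsSoInvariant.apply_eq_zero (hQ : IsSoInvariant Q B V₁ V₂) (hB : IsPosDefSymm B)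
    (horth : ∀ x ∈ V₁, ∀ y ∈ V₂, B x y = 0) {x y : V} (hx : x ∈ V₁) (hy : y ∈ V₂) :
    Q x y = 0 := by
  obtain ⟨k, hk, hkx⟩ := exists_mem_soGroup_apply_eq hB horth hx (V₁.neg_mem hx) (by simp)
  have := hQ k hk x y
  rw [hkx, hk.2.1 y hy, map_neg, LinearMap.neg_apply] at this
  linarith

lemma IsSoInvariant.mul_eq_mul (hQ : IsSoInvariant Q B V₁ V₂) (hB : IsPosDefSymm B)
    (horth : ∀ x ∈ V₁, ∀ y ∈ V₂, B x y = 0) {x y : V} (hx : x ∈ V₁) (hy : y ∈ V₁) :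
    Q x x * B y y = Q y y * B x x := by
  rcases eq_or_ne y 0 with rfl | hy0
  · simp
  have hBy := hB.2 y hy0
  obtain ⟨c, hc⟩ : ∃ c : ℝ, c * c = B x x / B y y :=
    ⟨_, Real.mul_self_sqrt (div_nonneg (hB.nonneg x) hBy.le)⟩
  have hBc : B x x = B (c • y) (c • y) := by
    simp only [map_smul, LinearMap.smul_apply, smul_eq_mul]
    rw [← mul_assoc, hc, div_mul_cancel₀ _ hBy.ne']
  obtain ⟨k, hk, hkx⟩ := exists_mem_soGroup_apply_eq hB horth hx (V₁.smul_mem c hy) hBc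
  have h := hQ k hk x x
  rw [hkx] at h
  rw [← h, hBc]
  simp only [map_smul, LinearMap.smul_apply, smul_eq_mul]
  ring

/-- The orthogonal group of `V₁` acts transitively on the latitude spheres. -/
lemma IsSoInvariant.exists_apply_eq (hQ : IsSoInvariant Q B V₁ V₂) (hB : IsPosDefSymm B)
    (hQp : IsPosDefSymm Q) (horth : ∀ x ∈ V₁, ∀ y ∈ V₂, B x y = 0) (hcompl : IsCompl V₁ V₂)
    {e : V} (he : e ∈ V₂) (he0 : e ≠ 0) (hspan : ∀ z ∈ V₂, ∃ t : ℝ, t • e = z)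
    {y z : V} (hyz : Q y y = Q z z) (hye : Q y e = Q z e) :
    ∃ k ∈ soGroup B V₁ V₂, (k : V →L[ℝ] V) z = y := by
  obtain ⟨y₁, y₂, hy₁, hy₂, rfl⟩ :=
    Submodule.codisjoint_iff_exists_add_eq.1 hcompl.codisjoint y
  obtain ⟨z₁, z₂, hz₁, hz₂, rfl⟩ :=
    Submodule.codisjoint_iff_exists_add_eq.1 hcompl.codisjoint z
  have hzero {x v : V} (hx : x ∈ V₁) (hv : v ∈ V₂) : Q x v = 0 :=
    hQ.apply_eq_zero hB horth hx hv
  have h₂ : y₂ = z₂ := by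
    obtain ⟨s, rfl⟩ := hspan y₂ hy₂
    obtain ⟨t, rfl⟩ := hspan z₂ hz₂
    simp only [map_add, LinearMap.add_apply, map_smul, LinearMap.smul_apply, smul_eq_mul,
      hzero hy₁ he, hzero hz₁ he, zero_add] at hye
    rw [mul_right_cancel₀ (hQp.2 e he0).ne' hye]
  subst h₂
  rw [hQp.apply_add_self, hQp.apply_add_self, hzero hy₁ hy₂, hzero hz₁ hy₂] at hyz
  have h₁ : Q z₁ z₁ = Q y₁ y₁ := by linarith
  have hB₁ : B z₁ z₁ = B y₁ y₁ := by
    have hmul := hQ.mul_eq_mul hB horth hy₁ hz₁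
    rw [h₁] at hmul
    rcases eq_or_ne y₁ 0 with rfl | h0
    · have hz0 : z₁ = 0 := hQp.eq_zero (by rw [h₁]; simp)
      rw [hz0]
    · exact mul_left_cancel₀ (hQp.2 y₁ h0).ne' hmul
  obtain ⟨k, hk, hkz⟩ := exists_mem_soGroup_apply_eq hB horth hz₁ hy₁ hB₁
  exact ⟨k, hk, by rw [map_add, hkz, hk.2.1 y₂ hy₂]⟩

end Invariant

/-- A nonempty subset of a sphere of dimension at least one which contains a cap of uniform
size around each of its points is the whole sphere. -/
lemma IsPosDefSymm.mem_of_forall_cap_subset [FiniteDimensional ℝ V] (hV : 1 < finrank ℝ V)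
    {Q : V →ₗ[ℝ] V →ₗ[ℝ] ℝ} (hQ : IsPosDefSymm Q) {N c : ℝ} (hN : 0 < N) (hcN : c < N)
    {O : Set V} {e : V} (he : e ∈ O) (heN : Q e e = N)
    (hcap : ∀ y z, z ∈ O → Q y y = N → c ≤ Q y z → y ∈ O) {y : V} (hy : Q y y = N) :
    y ∈ O := by
  set ν : V → V := fun y => √(N / Q y y) • y with hν
  have hνself {y : V} (hy : y ≠ 0) : Q (ν y) (ν y) = N := by
    have hp := hQ.2 y hy
    simp only [hν, map_smul, LinearMap.smul_apply, smul_eq_mul]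
    rw [← mul_assoc, Real.mul_self_sqrt (div_pos hN hp).le, div_mul_cancel₀ _ hp.ne']
  have hνN {y : V} (hy : Q y y = N) : ν y = y := by
    simp only [hν]
    rw [hy, div_self hN.ne', Real.sqrt_one, one_smul]
  have hne {y : V} (hy : Q y y = N) : y ≠ 0 := by
    rintro rfl
    simp at hy
    exact hN.ne hy
  have hQc : Continuous fun y => Q y y := by
    have : Continuous fun y => LinearMap.toContinuousLinearMap (Q y) y :=
      (((LinearMap.toContinuousLinearMap : (V →ₗ[ℝ] ℝ) ≃ₗ[ℝ] _).toLinearMap ∘ₗ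
        Q).continuous_of_finiteDimensional).clm_apply continuous_id
    exact this
  have hνc {y : V} (hy : y ≠ 0) : ContinuousAt ν y :=
    ((continuousAt_const.div hQc.continuousAt (hQ.2 y hy).ne').sqrt).smul continuousAt_id
  have hnear {y : V} (hy : y ≠ 0) : ∀ᶠ z in 𝓝 y, z ≠ 0 ∧ c < Q (ν z) (ν y) := by
    have h1 : ContinuousAt (fun z => Q.flip (ν y) (ν z)) y :=
      ((Q.flip (ν y)).continuous_of_finiteDimensional.continuousAt).comp (hνc hy)
    have h2 : c < Q.flip (ν y) (ν y) := by
      rw [LinearMap.flip_apply, hνself hy]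
      exact hcN
    exact (eventually_ne_nhds hy).and (h1.eventually (lt_mem_nhds h2))
  have hsub : ({0}ᶜ : Set V) ⊆ {y | y ≠ 0 ∧ ν y ∈ O} := by
    refine IsPreconnected.subset_of_closure_inter_subset
      (isConnected_compl_singleton_of_one_lt_rank ?_ 0).isPreconnected ?_ ?_ ?_
    · rw [← finrank_eq_rank]
      exact_mod_cast hV
    · rw [isOpen_iff_mem_nhds]
      rintro y ⟨hy0, hyO⟩
      filter_upwards [hnear hy0] with z hz
      exact ⟨hz.1, hcap _ _ hyO (hνself hz.1) hz.2.le⟩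
    · exact ⟨e, hne heN, hne heN, by rwa [hνN heN]⟩
    · rintro y ⟨hyc, hy0⟩
      obtain ⟨z, ⟨hz0, hzc⟩, -, hzO⟩ := mem_closure_iff_nhds.1 hyc _ (hnear hy0)
      exact ⟨hy0, hcap _ _ hzO (hνself hy0) (by rw [hQ.1]; exact hzc.le)⟩
  have := (hsub (hne hy)).2
  rwa [hνN hy] at this

lemma mem_linIso_of_mem_idComp {F : V → ℝ} {g : (V →L[ℝ] V)ˣ}
    (hg : g ∈ idComp (linIso F)) : g ∈ linIso F := by
  obtain ⟨a, -, rfl⟩ := hg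
  exact a.2

lemma isPreconnected_idComp (H : Subgroup (V →L[ℝ] V)ˣ) : IsPreconnected (idComp H) :=
  isPreconnected_connectedComponent.image _ continuous_subtype_val.continuousOn

lemma one_mem_idComp (H : Subgroup (V →L[ℝ] V)ˣ) : (1 : (V →L[ℝ] V)ˣ) ∈ idComp H :=
  ⟨1, mem_connectedComponent, rfl⟩

lemma subset_idComp_of_isPreconnected {H : Subgroup (V →L[ℝ] V)ˣ} {S : Set (V →L[ℝ] V)ˣ}
    (hS : IsPreconnected S) (h1 : 1 ∈ S) (hSH : S ⊆ H) : S ⊆ idComp H := by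
  have himage : ((↑) : H → (V →L[ℝ] V)ˣ) '' ((↑) ⁻¹' S) = S :=
    Set.image_preimage_eq_of_subset (by rw [Subtype.range_coe]; exact hSH)
  have hpre : IsPreconnected (((↑) : H → (V →L[ℝ] V)ˣ) ⁻¹' S) :=
    IsInducing.subtypeVal.isPreconnected_image.1 ((congrArg IsPreconnected himage).mpr hS)
  rw [← himage]
  exact Set.image_mono (hpre.subset_connectedComponent (x := (1 : H)) h1)

/-- If the connected isometry group moves the axis, then it is transitive on directions, so
the norm is Euclidean. -/
lemma isEuclideanNorm_of_apply_ne [FiniteDimensional ℝ V] (hV : 1 < finrank ℝ V) {F : V → ℝ}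
    (hpos : ∀ y, y ≠ 0 → 0 < F y) (hhom : ∀ c : ℝ, 0 < c → ∀ y, F (c • y) = c * F y)
    {B Q : V →ₗ[ℝ] V →ₗ[ℝ] ℝ} {V₁ V₂ : Submodule ℝ V} (hB : IsPosDefSymm B)
    (hQp : IsPosDefSymm Q)
    (hQ : ∀ g ∈ linIso F, ∀ x y, Q ((g : V →L[ℝ] V) x) ((g : V →L[ℝ] V) y) = Q x y)
    (hle : soGroup B V₁ V₂ ≤ linIso F)
    (horth : ∀ x ∈ V₁, ∀ y ∈ V₂, B x y = 0) (hcompl : IsCompl V₁ V₂)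
    {e : V} (he : e ∈ V₂) (he0 : e ≠ 0) (hspan : ∀ z ∈ V₂, ∃ t : ℝ, t • e = z)
    {g₀ : (V →L[ℝ] V)ˣ} (hg₀ : g₀ ∈ idComp (linIso F)) (hne : (g₀ : V →L[ℝ] V) e ≠ e) :
    IsEuclideanNorm F := by
  have hQso : IsSoInvariant Q B V₁ V₂ := fun k hk => hQ k (hle hk)
  set N := Q e e with hN
  have hNpos : 0 < N := hQp.2 e he0
  set h : (V →L[ℝ] V)ˣ → ℝ := fun g => Q.flip e ((g : V →L[ℝ] V) e) with hh
  have hhc : Continuous h := (Q.flip e).continuous_of_finiteDimensional.comp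
    (Units.continuous_val.clm_apply continuous_const)
  have hord : (h '' idComp (linIso F)).OrdConnected :=
    ((isPreconnected_idComp _).image h hhc.continuousOn).ordConnected
  have hlt : h g₀ < N := by
    have h1 := hQp.2 _ (sub_ne_zero.2 hne)
    rw [hQp.apply_sub_self, hQ g₀ (mem_linIso_of_mem_idComp hg₀)] at h1
    change Q _ e < N
    linarith
  have hcap (y : V) (hy : Q y y = N) (hyc : h g₀ ≤ Q y e) :
      ∃ g ∈ linIso F, (g : V →L[ℝ] V) e = y := by
    have hyN : Q y e ≤ N := by
      have h1 := hQp.nonneg (y - e)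
      rw [hQp.apply_sub_self, hy] at h1
      linarith
    obtain ⟨g, hg, hgy⟩ : Q y e ∈ h '' idComp (linIso F) :=
      hord.out ⟨g₀, hg₀, rfl⟩ ⟨1, one_mem_idComp _, rfl⟩ ⟨hyc, hyN⟩
    have hgF := mem_linIso_of_mem_idComp hg
    obtain ⟨k, hk, hky⟩ := hQso.exists_apply_eq hB hQp horth hcompl he he0 hspan
      (y := y) (z := (g : V →L[ℝ] V) e) (by rw [hQ g hgF, hy]) hgy.symm
    exact ⟨k * g, mul_mem (hle hk) hgF, hky⟩
  have horbit (y : V) (hy : Q y y = N) : ∃ g ∈ linIso F, (g : V →L[ℝ] V) e = y := by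
    refine hQp.mem_of_forall_cap_subset hV hNpos hlt
      (O := {y | ∃ g ∈ linIso F, (g : V →L[ℝ] V) e = y}) ⟨1, one_mem _, rfl⟩ rfl ?_ hy
    rintro y _ ⟨g, hg, rfl⟩ hy hyc
    have hinv (x z : V) : Q (((g⁻¹ : (V →L[ℝ] V)ˣ) : V →L[ℝ] V) x)
        (((g⁻¹ : (V →L[ℝ] V)ˣ) : V →L[ℝ] V) z) = Q x z := hQ _ (inv_mem hg) x z
    obtain ⟨k, hk, hky⟩ := hcap (((g⁻¹ : (V →L[ℝ] V)ˣ) : V →L[ℝ] V) y)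
      (by rw [hinv, hy]) (by
        rw [← hinv, unit_inv_apply_apply] at hyc
        exact hyc)
    refine ⟨g * k, mul_mem hg hk, ?_⟩
    change (g : V →L[ℝ] V) ((k : V →L[ℝ] V) e) = y
    rw [hky, unit_apply_inv_apply]
  have hscale : 0 < F e ^ 2 / N := div_pos (pow_pos (hpos e he0) 2) hNpos
  refine ⟨(F e ^ 2 / N) • Q, ⟨fun x y => ?_, fun x hx => mul_pos hscale (hQp.2 x hx)⟩,
    fun y => ?_⟩
  · simp only [LinearMap.smul_apply]
    rw [hQp.1]
  · simp only [LinearMap.smul_apply, smul_eq_mul]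
    rcases eq_or_ne y 0 with rfl | hy
    · have := hhom 2 two_pos 0
      rw [smul_zero] at this
      have hF0 : F 0 = 0 := by linarith
      simp [hF0]
    · have hp := hQp.2 y hy
      set c := √(N / Q y y) with hc
      have hc0 : 0 < c := Real.sqrt_pos.2 (div_pos hNpos hp)
      have hc2 : c * c = N / Q y y := Real.mul_self_sqrt (div_pos hNpos hp).le
      obtain ⟨g, hg, hgy⟩ := horbit (c • y) (by
        simp only [map_smul, LinearMap.smul_apply, smul_eq_mul]
        rw [← mul_assoc, hc2, div_mul_cancel₀ _ hp.ne'])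
      have hFe : F e = c * F y := by rw [← hhom c hc0, ← hgy]; exact (hg e).symm
      have hN2 : N = c * c * Q y y := by rw [hc2, div_mul_cancel₀ _ hp.ne']
      rw [hFe, hN2]
      field_simp

/-- The Cayley transform. -/
def cayley (X : V →L[ℝ] V) : V →L[ℝ] V := (1 - X) * Ring.inverse (1 + X)

lemma cayley_apply_one_add {X : V →L[ℝ] V} (hX : IsUnit (1 + X)) (z : V) :
    cayley X (z + X z) = z - X z := by
  have h : cayley X * (1 + X) = 1 - X := by
    rw [cayley, mul_assoc, Ring.inverse_mul_cancel _ hX, mul_one]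
  exact congrArg (fun f : V →L[ℝ] V => f z) h

lemma exists_add_apply_eq {X : V →L[ℝ] V} (hX : IsUnit (1 + X)) (y : V) :
    ∃ z, z + X z = y := by
  obtain ⟨u, hu⟩ := hX
  refine ⟨((u⁻¹ : (V →L[ℝ] V)ˣ) : V →L[ℝ] V) y, ?_⟩
  have := unit_apply_inv_apply u y
  rw [hu] at this
  exact this

lemma isUnit_one_add_cayley {X : V →L[ℝ] V} (hX : IsUnit (1 + X)) :
    IsUnit (1 + cayley X) := by
  have h : 1 + cayley X = (2 : ℝ) • Ring.inverse (1 + X) := by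
    calc 1 + cayley X = (1 + X) * Ring.inverse (1 + X) + (1 - X) * Ring.inverse (1 + X) := by
          rw [Ring.mul_inverse_cancel _ hX, cayley]
      _ = ((1 + X) + (1 - X)) * Ring.inverse (1 + X) := (add_mul _ _ _).symm
      _ = (2 : ℝ) • Ring.inverse (1 + X) := by
          rw [add_add_sub_cancel, two_smul, add_mul, one_mul]
  rw [h]
  exact (hX.ringInverse).smul (Units.mk0 (2 : ℝ) two_ne_zero)

lemma cayley_cayley {X : V →L[ℝ] V} (hX : IsUnit (1 + X)) : cayley (cayley X) = X := by
  ext y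
  obtain ⟨z, rfl⟩ := exists_add_apply_eq (isUnit_one_add_cayley hX) y
  obtain ⟨v, rfl⟩ := exists_add_apply_eq hX z
  rw [cayley_apply_one_add (isUnit_one_add_cayley hX), cayley_apply_one_add hX]
  simp only [map_add, map_sub]
  abel

lemma contDiffAt_cayley [CompleteSpace V] {X : V →L[ℝ] V} (hX : IsUnit (1 + X)) :
    ContDiffAt ℝ 1 (cayley (V := V)) X := by
  obtain ⟨u, hu⟩ := hX
  have h1 : ContDiffAt ℝ 1 (Ring.inverse : (V →L[ℝ] V) → _) (1 + X) := by
    rw [← hu]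
    exact contDiffAt_ringInverse ℝ u
  exact (contDiffAt_const.sub contDiffAt_id).mul
    (h1.comp X (contDiffAt_const.add contDiffAt_id))

lemma dimH_image_cayley_le [FiniteDimensional ℝ V] {s : Set (V →L[ℝ] V)}
    (hs : ∀ X ∈ s, IsUnit (1 + X)) : dimH (cayley '' s) ≤ dimH s := by
  have : CompleteSpace V := FiniteDimensional.complete ℝ V
  have : ProperSpace (V →L[ℝ] V) := FiniteDimensional.proper ℝ _
  refine dimH_image_le_of_locally_lipschitzOn fun X hX => ?_
  obtain ⟨K, t, ht, hK⟩ := (contDiffAt_cayley (hs X hX)).exists_lipschitzOnWith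
  exact ⟨K, t, mem_nhdsWithin_of_mem_nhds ht, hK⟩

/-- The space of endomorphisms which are skew-symmetric for `Q`. -/
def skewEnd (Q : V →ₗ[ℝ] V →ₗ[ℝ] ℝ) :
    Submodule ℝ (V →L[ℝ] V) where
  carrier := {X | ∀ y, Q (X y) y = 0}
  add_mem' {X Y} hX hY y := by
    simp only [add_apply, map_add, LinearMap.add_apply, hX y, hY y, add_zero]
  zero_mem' y := by simp
  smul_mem' c X hX y := by
    simp only [smul_apply, map_smul, LinearMap.smul_apply, hX y, smul_zero]

/-- The space of endomorphisms which vanish on the subspace `W`. -/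
def vanishingEnd (W : Submodule ℝ V) : Submodule ℝ (V →L[ℝ] V) where
  carrier := {X | ∀ y ∈ W, X y = 0}
  add_mem' {X Y} hX hY y hy := by simp [hX y hy, hY y hy]
  zero_mem' y _ := rfl
  smul_mem' c X hX y hy := by simp [hX y hy]

lemma isUnit_one_add_of_mem_skewEnd [FiniteDimensional ℝ V] {Q : V →ₗ[ℝ] V →ₗ[ℝ] ℝ}
    (hQ : IsPosDefSymm Q) {X : V →L[ℝ] V} (hX : X ∈ skewEnd Q) : IsUnit (1 + X) := by
  have hinj : Function.Injective ((1 + X : V →L[ℝ] V) : V →ₗ[ℝ] V) := by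
    rw [← LinearMap.ker_eq_bot, LinearMap.ker_eq_bot']
    intro x hx
    have h1 : x + X x = 0 := hx
    have h2 : Q (x + X x) x = 0 := by rw [h1]; simp
    rw [map_add, LinearMap.add_apply, hX x, add_zero] at h2
    exact hQ.eq_zero h2
  obtain ⟨a, ha⟩ := exists_unit_of_injective _ hinj
  exact ⟨a, ContinuousLinearMap.ext ha⟩

lemma cayley_preserves {Q : V →ₗ[ℝ] V →ₗ[ℝ] ℝ} (hQ : IsPosDefSymm Q) {X : V →L[ℝ] V}
    (hX : X ∈ skewEnd Q) (hu : IsUnit (1 + X)) (y : V) :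
    Q (cayley X y) (cayley X y) = Q y y := by
  obtain ⟨z, rfl⟩ := exists_add_apply_eq hu y
  rw [cayley_apply_one_add hu, hQ.apply_sub_self, hQ.apply_add_self, hQ.1 z (X z), hX z]
  ring

lemma cayley_mem_skewEnd {Q : V →ₗ[ℝ] V →ₗ[ℝ] ℝ} (hQ : IsPosDefSymm Q) {A : V →L[ℝ] V}
    (hA : ∀ y, Q (A y) (A y) = Q y y) (hu : IsUnit (1 + A)) : cayley A ∈ skewEnd Q := by
  intro y
  obtain ⟨z, rfl⟩ := exists_add_apply_eq hu y
  rw [cayley_apply_one_add hu]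
  simp only [map_sub, map_add, LinearMap.sub_apply, hA z, hQ.1 (A z) z]
  ring

lemma cayley_mem_vanishingEnd {W : Submodule ℝ V} {A : V →L[ℝ] V}
    (hA : ∀ y ∈ W, A y = y) (hu : IsUnit (1 + A)) : cayley A ∈ vanishingEnd W := by
  intro y hy
  have h : y = (2⁻¹ : ℝ) • y + A ((2⁻¹ : ℝ) • y) := by
    rw [map_smul, hA y hy, ← add_smul]
    norm_num
  rw [h, cayley_apply_one_add hu, map_smul, hA y hy, sub_self]

lemma dimH_submodule {E : Type*} [NormedAddCommGroup E] [NormedSpace ℝ E]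
    [FiniteDimensional ℝ E] (p : Submodule ℝ E) : dimH (p : Set E) = finrank ℝ p := by
  have h := p.subtypeₗᵢ.isometry.dimH_image Set.univ
  rw [Set.image_univ, Real.dimH_univ_eq_finrank] at h
  rw [← h]
  congr 1
  exact Subtype.range_coe.symm

lemma dimH_idComp_soGroup_le [FiniteDimensional ℝ V] {B : V →ₗ[ℝ] V →ₗ[ℝ] ℝ}
    (hB : IsPosDefSymm B) (V₁ V₂ : Submodule ℝ V) :
    dimH ((fun A : (V →L[ℝ] V)ˣ => (A : V →L[ℝ] V)) '' idComp (soGroup B V₁ V₂)) ≤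
      finrank ℝ (skewEnd B ⊓ vanishingEnd V₂ : Submodule ℝ (V →L[ℝ] V)) := by
  have : CompleteSpace V := FiniteDimensional.complete ℝ V
  have : ProperSpace (V →L[ℝ] V) := FiniteDimensional.proper ℝ _
  by_contra! hlt
  obtain ⟨_, ⟨a, ha, rfl⟩, hdim⟩ := exists_mem_nhdsWithin_lt_dimH_of_lt_dimH hlt
  have hnhds : {M : V →L[ℝ] V | IsUnit (1 + ((a⁻¹ : (V →L[ℝ] V)ˣ) : V →L[ℝ] V) * M)} ∈
      𝓝 (a : V →L[ℝ] V) := by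
    refine (Units.isOpen.preimage (continuous_const.add
      (continuous_const.mul continuous_id))).mem_nhds ?_
    change IsUnit (1 + ((a⁻¹ : (V →L[ℝ] V)ˣ) : V →L[ℝ] V) * (a : V →L[ℝ] V))
    rw [Units.inv_mul, ← two_smul ℝ (1 : V →L[ℝ] V)]
    exact isUnit_one.smul (Units.mk0 (2 : ℝ) two_ne_zero)
  have hlt' := hdim _ (Filter.inter_mem self_mem_nhdsWithin (mem_nhdsWithin_of_mem_nhds hnhds))
  refine hlt'.not_ge ?_
  set k : Submodule ℝ (V →L[ℝ] V) := skewEnd B ⊓ vanishingEnd V₂ with hk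
  set L : (V →L[ℝ] V) →L[ℝ] (V →L[ℝ] V) :=
    ContinuousLinearMap.mul ℝ (V →L[ℝ] V) (a : V →L[ℝ] V) with hL
  calc dimH _ ≤ dimH (L '' (cayley '' (k : Set (V →L[ℝ] V)))) := by
        refine dimH_mono ?_
        rintro _ ⟨⟨b, hb, rfl⟩, hu⟩
        set c : (V →L[ℝ] V)ˣ := a⁻¹ * b with hc
        have hcK : c ∈ soGroup B V₁ V₂ := by
          obtain ⟨a', -, rfl⟩ := ha
          obtain ⟨b', -, rfl⟩ := hb
          exact mul_mem (inv_mem a'.2) b'.2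
        have hu : IsUnit (1 + (c : V →L[ℝ] V)) := hu
        refine ⟨(c : V →L[ℝ] V), ⟨cayley c, ⟨cayley_mem_skewEnd hB
          (hB.apply_of_mem_soGroup hcK) hu, cayley_mem_vanishingEnd hcK.2.1 hu⟩,
          cayley_cayley hu⟩, ?_⟩
        change (a : V →L[ℝ] V) * (c : V →L[ℝ] V) = (b : V →L[ℝ] V)
        rw [← Units.val_mul, hc, mul_inv_cancel_left]
    _ ≤ dimH (cayley '' (k : Set (V →L[ℝ] V))) := L.lipschitz.dimH_image_le _
    _ ≤ dimH (k : Set (V →L[ℝ] V)) :=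
        dimH_image_cayley_le fun X hX => isUnit_one_add_of_mem_skewEnd hB hX.1
    _ = finrank ℝ k := dimH_submodule k

lemma exists_mem_idComp_linIso_eq_cayley [FiniteDimensional ℝ V] {F : V → ℝ}
    (hF : ∀ y, 0 ≤ F y) {Q : V →ₗ[ℝ] V →ₗ[ℝ] ℝ} (hQ : IsPosDefSymm Q)
    (hFQ : ∀ y, F y ^ 2 = Q y y) {X : V →L[ℝ] V} (hX : X ∈ skewEnd Q) :
    ∃ g ∈ idComp (linIso F), (g : V →L[ℝ] V) = cayley X := by
  have : CompleteSpace V := FiniteDimensional.complete ℝ V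
  have hsk (t : ℝ) : t • X ∈ skewEnd Q := (skewEnd Q).smul_mem t hX
  have hunit (t : ℝ) := isUnit_one_add_of_mem_skewEnd hQ (hsk t)
  have hex (t : ℝ) : ∃ g : (V →L[ℝ] V)ˣ, (g : V →L[ℝ] V) = cayley (t • X) := by
    obtain ⟨g, hg⟩ := exists_unit_of_injective (cayley (t • X) : V →ₗ[ℝ] V)
      (hQ.injective_of_preserves (cayley_preserves hQ (hsk t) (hunit t)))
    exact ⟨g, ContinuousLinearMap.ext hg⟩
  choose u hu using hex
  have hcont : Continuous u := by
    rw [Units.isOpenEmbedding_val.isInducing.continuous_iff]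
    refine continuous_iff_continuousAt.2 fun t => ?_
    have h1 : ContinuousAt (fun t : ℝ => t • X) t := by fun_prop
    have h2 := ContinuousAt.comp (f := fun t : ℝ => t • X)
      (contDiffAt_cayley (hunit t)).continuousAt h1
    exact h2.congr (Filter.Eventually.of_forall fun s => (hu s).symm)
  have hrange : Set.range u ⊆ idComp (linIso F) := by
    refine subset_idComp_of_isPreconnected (isPreconnected_range hcont) ⟨0, ?_⟩ ?_
    · ext1
      rw [hu, zero_smul, cayley, sub_zero, add_zero, Ring.inverse_one, mul_one, Units.val_one]
    · rintro _ ⟨t, rfl⟩ y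
      refine (sq_eq_sq₀ (hF _) (hF _)).1 ?_
      rw [hFQ, hFQ, hu, cayley_preserves hQ (hsk t) (hunit t)]
  exact ⟨u 1, hrange ⟨1, rfl⟩, by rw [hu, one_smul]⟩

lemma finrank_skewEnd_le_dimH_idComp_linIso [FiniteDimensional ℝ V] {F : V → ℝ}
    (hF : ∀ y, 0 ≤ F y) {Q : V →ₗ[ℝ] V →ₗ[ℝ] ℝ} (hQ : IsPosDefSymm Q)
    (hFQ : ∀ y, F y ^ 2 = Q y y) :
    (finrank ℝ (skewEnd Q) : ENNReal) ≤
      dimH ((fun A : (V →L[ℝ] V)ˣ => (A : V →L[ℝ] V)) '' idComp (linIso F)) := by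
  rw [← dimH_submodule]
  set S := (fun A : (V →L[ℝ] V)ˣ => (A : V →L[ℝ] V)) '' idComp (linIso F) with hS
  calc dimH (skewEnd Q : Set (V →L[ℝ] V)) ≤ dimH (cayley '' (S ∩ {M | IsUnit (1 + M)})) := by
        refine dimH_mono fun X hX => ?_
        have hu := isUnit_one_add_of_mem_skewEnd hQ hX
        obtain ⟨g, hg, hgX⟩ := exists_mem_idComp_linIso_eq_cayley hF hQ hFQ hX
        exact ⟨cayley X, ⟨⟨g, hg, hgX⟩, isUnit_one_add_cayley hu⟩, cayley_cayley hu⟩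
    _ ≤ dimH (S ∩ {M | IsUnit (1 + M)}) := dimH_image_cayley_le fun X hX => hX.2
    _ ≤ dimH S := dimH_mono Set.inter_subset_left

lemma IsPosDefSymm.apply_apply_of_preserves {Q : V →ₗ[ℝ] V →ₗ[ℝ] ℝ} (hQ : IsPosDefSymm Q)
    {f : V →L[ℝ] V} (hf : ∀ y, Q (f y) (f y) = Q y y) (x y : V) : Q (f x) (f y) = Q x y := by
  have h := hf (x + y)
  rw [map_add, hQ.apply_add_self, hQ.apply_add_self, hf, hf] at h
  linarith

lemma IsPosDefSymm.mem_of_forall_apply_eq_zero {B : V →ₗ[ℝ] V →ₗ[ℝ] ℝ} (hB : IsPosDefSymm B)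
    {V₁ V₂ : Submodule ℝ V} (horth : ∀ x ∈ V₁, ∀ y ∈ V₂, B x y = 0) (hcompl : IsCompl V₁ V₂)
    {x : V} (hx : ∀ y ∈ V₂, B x y = 0) : x ∈ V₁ := by
  obtain ⟨x₁, x₂, hx₁, hx₂, rfl⟩ :=
    Submodule.codisjoint_iff_exists_add_eq.1 hcompl.codisjoint x
  have h := hx x₂ hx₂
  rw [map_add, LinearMap.add_apply, horth x₁ hx₁ x₂ hx₂, zero_add] at h
  rw [hB.eq_zero h, add_zero]
  exact hx₁

section Invariant

variable [FiniteDimensional ℝ V] {B Q : V →ₗ[ℝ] V →ₗ[ℝ] ℝ} {V₁ V₂ : Submodule ℝ V}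

lemma IsSoInvariant.apply_self_eq (hQ : IsSoInvariant Q B V₁ V₂) (hB : IsPosDefSymm B)
    (horth : ∀ x ∈ V₁, ∀ y ∈ V₂, B x y = 0) {x y : V} (hx : x ∈ V₁) (hy : y ∈ V₁)
    (hxy : B x x = B y y) : Q x x = Q y y := by
  obtain ⟨k, hk, hkx⟩ := exists_mem_soGroup_apply_eq hB horth hx hy hxy
  rw [← hkx, hQ k hk]

lemma IsSoInvariant.mem_soGroup_of_apply_eq (hQ : IsSoInvariant Q B V₁ V₂)
    (hB : IsPosDefSymm B) (hQp : IsPosDefSymm Q) (horth : ∀ x ∈ V₁, ∀ y ∈ V₂, B x y = 0)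
    (hcompl : IsCompl V₁ V₂) {e : V} (hspan : ∀ z ∈ V₂, ∃ t : ℝ, t • e = z)
    {g : (V →L[ℝ] V)ˣ}
    (hg : ∀ x y, Q ((g : V →L[ℝ] V) x) ((g : V →L[ℝ] V) y) = Q x y)
    (hge : (g : V →L[ℝ] V) e = e) : g ∈ soGroup B V₁ V₂ := by
  have hQorth : ∀ x ∈ V₁, ∀ y ∈ V₂, Q x y = 0 := fun x hx y hy =>
    hQ.apply_eq_zero hB horth hx hy
  have hg₂ : ∀ y ∈ V₂, (g : V →L[ℝ] V) y = y := fun y hy => by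
    obtain ⟨t, rfl⟩ := hspan y hy
    rw [map_smul, hge]
  have hg₁ : ∀ x ∈ V₁, (g : V →L[ℝ] V) x ∈ V₁ := fun x hx =>
    hQp.mem_of_forall_apply_eq_zero hQorth hcompl fun y hy => by
      rw [← hQorth x hx y hy, ← hg x y, hg₂ y hy]
  have hgB : ∀ x ∈ V₁, B ((g : V →L[ℝ] V) x) ((g : V →L[ℝ] V) x) = B x x := fun x hx => by
    have h := hQ.mul_eq_mul hB horth hx (hg₁ x hx)
    rw [hg] at h
    rcases eq_or_ne x 0 with rfl | hx0
    · simp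
    · exact mul_left_cancel₀ (hQp.2 x hx0).ne' h
  refine mem_soGroup (fun y => ?_) hg₂ hg₁
  obtain ⟨y₁, y₂, hy₁, hy₂, rfl⟩ :=
    Submodule.codisjoint_iff_exists_add_eq.1 hcompl.codisjoint y
  rw [map_add, hg₂ y₂ hy₂, hB.apply_add_self, hB.apply_add_self, hgB y₁ hy₁,
    horth _ (hg₁ y₁ hy₁) y₂ hy₂, horth y₁ hy₁ y₂ hy₂]

lemma IsSoInvariant.skewEnd_inf_vanishingEnd_lt (hQ : IsSoInvariant Q B V₁ V₂)
    (hB : IsPosDefSymm B) (hQp : IsPosDefSymm Q) (horth : ∀ x ∈ V₁, ∀ y ∈ V₂, B x y = 0)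
    (hcompl : IsCompl V₁ V₂) {u e : V} (hu : u ∈ V₁) (hu0 : u ≠ 0) (he : e ∈ V₂)
    (he0 : e ≠ 0) : skewEnd B ⊓ vanishingEnd V₂ < skewEnd Q := by
  refine lt_of_le_of_ne ?_ ?_
  · rintro X ⟨hXB, hX₂⟩ y
    have hX₁ (x : V) : X x ∈ V₁ :=
      hB.mem_of_forall_apply_eq_zero horth hcompl fun v hv => by
        have h := hXB (x + v)
        rwa [map_add X, hX₂ v hv, add_zero, map_add, hXB x, zero_add] at h
    obtain ⟨x, v, hx, hv, rfl⟩ := Submodule.codisjoint_iff_exists_add_eq.1 hcompl.codisjoint y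
    rw [map_add X, hX₂ v hv, add_zero, map_add, hQ.apply_eq_zero hB horth (hX₁ x) hv, add_zero]
    have h := hQ.apply_self_eq hB horth (V₁.add_mem (hX₁ x) hx) (V₁.sub_mem (hX₁ x) hx) (by
      rw [hB.apply_add_self, hB.apply_sub_self, hXB x]
      ring)
    rw [hQp.apply_add_self, hQp.apply_sub_self] at h
    linarith
  · intro heq
    have hue : Q u e = 0 := hQ.apply_eq_zero hB horth hu he
    let X : V →L[ℝ] V :=
      LinearMap.toContinuousLinearMap ((Q.flip e).smulRight u - (Q.flip u).smulRight e)
    have hX (v : V) : X v = Q v e • u - Q v u • e := rfl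
    have hXmem : X ∈ skewEnd Q := fun v => by
      rw [hX]
      simp only [map_sub, map_smul, LinearMap.sub_apply, LinearMap.smul_apply, smul_eq_mul,
        hQp.1 u v, hQp.1 e v]
      ring
    rw [← heq] at hXmem
    have h := hXmem.2 e he
    rw [hX, hQp.1 e u, hue, zero_smul, sub_zero] at h
    exact (smul_ne_zero (hQp.2 e he0).ne' hu0) h

end Invariant

end LinearIsometryDimension

/-- with data as in the lemma, the `(α,β)`-norm `F` is Euclidean iff
`dim L₀(V, F) > dim SO(V₁, α)` (Hausdorff dimension in the space of endomorphisms). -/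
theorem statement1 {V : Type*} [NormedAddCommGroup V] [NormedSpace ℝ V]
    [FiniteDimensional ℝ V] (n : ℕ) (hn : 1 < n) (hdim : finrank ℝ V = n)
    (F : V → ℝ) (φ : ℝ → ℝ) (B : V →ₗ[ℝ] V →ₗ[ℝ] ℝ) (β : V →ₗ[ℝ] ℝ)
    (hMink : IsMinkowskiNorm F) (hdatum : IsAlphaBetaDatum F φ B β)
    (V₁ V₂ : Submodule ℝ V) (hcompl : IsCompl V₁ V₂)
    (horth : ∀ x ∈ V₁, ∀ y ∈ V₂, B x y = 0)
    (hdimV₁ : finrank ℝ V₁ = n - 1)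
    (hker : β ≠ 0 → V₁ = LinearMap.ker β)
    (hSO : idComp (soGroup B V₁ V₂) ⊆ idComp (linIso F)) :
    IsEuclideanNorm F ↔
      dimH ((fun A : (V →L[ℝ] V)ˣ => (A : V →L[ℝ] V)) '' idComp (soGroup B V₁ V₂)) <
        dimH ((fun A : (V →L[ℝ] V)ˣ => (A : V →L[ℝ] V)) '' idComp (linIso F)) := by
  have hpos := hMink.pos
  have hhom := hMink.homog
  obtain ⟨hB, -, -, hF⟩ := hdatum
  have hV : 1 < finrank ℝ V := by rw [hdim]; exact hn
  have : Nontrivial V := Module.nontrivial_of_finrank_pos (R := ℝ) (by omega)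
  have hβ : ∀ x ∈ V₁, β x = 0 := fun x hx => by
    by_cases h : β = 0
    · simp [h]
    · rw [hker h] at hx
      exact hx
  have hle : soGroup B V₁ V₂ ≤ linIso F := soGroup_le_linIso hF hcompl hβ
  have hdimV₂ : finrank ℝ V₂ = 1 := by
    have := Submodule.finrank_add_eq_of_isCompl hcompl
    omega
  obtain ⟨⟨e, he⟩, he0, hspan'⟩ := finrank_eq_one_iff'.1 hdimV₂
  have he0 : e ≠ 0 := fun h => he0 (Subtype.ext h)
  have hspan : ∀ z ∈ V₂, ∃ t : ℝ, t • e = z := fun z hz => by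
    obtain ⟨t, ht⟩ := hspan' ⟨z, hz⟩
    exact ⟨t, congrArg Subtype.val ht⟩
  constructor
  · rintro ⟨Q, hQp, hFQ⟩
    obtain ⟨u, hu, hu0⟩ := V₁.exists_mem_ne_zero_of_ne_bot (by
      rintro rfl
      rw [finrank_bot] at hdimV₁
      omega)
    have hQ : IsSoInvariant Q B V₁ V₂ := fun k hk =>
      hQp.apply_apply_of_preserves fun y => by
        change Q ((k : V →L[ℝ] V) y) ((k : V →L[ℝ] V) y) = Q y y
        rw [← hFQ, ← hFQ, hle hk y]
    calc _ ≤ (finrank ℝ (skewEnd B ⊓ vanishingEnd V₂ : Submodule ℝ (V →L[ℝ] V)) : ENNReal) :=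
          dimH_idComp_soGroup_le hB V₁ V₂
      _ < (finrank ℝ (skewEnd Q) : ENNReal) := by
          exact_mod_cast Submodule.finrank_lt_finrank_of_lt
            (hQ.skewEnd_inf_vanishingEnd_lt hB hQp horth hcompl hu hu0 he he0)
      _ ≤ _ := finrank_skewEnd_le_dimH_idComp_linIso hMink.nonneg hQp hFQ
  · intro hlt
    obtain ⟨Q, hQp, hQ⟩ := exists_invariant_form hMink.continuous hpos hhom
    by_contra hne
    have hfix : ∀ g ∈ idComp (linIso F), (g : V →L[ℝ] V) e = e := fun g hg => by
      by_contra hge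
      exact hne (isEuclideanNorm_of_apply_ne hV hpos hhom hB hQp hQ hle horth hcompl he he0
        hspan hg hge)
    have hQso : IsSoInvariant Q B V₁ V₂ := fun k hk => hQ k (hle hk)
    have hsub : idComp (linIso F) ⊆ idComp (soGroup B V₁ V₂) :=
      subset_idComp_of_isPreconnected (isPreconnected_idComp _) (one_mem_idComp _)
        fun g hg => hQso.mem_soGroup_of_apply_eq hB hQp horth hcompl hspan
          (hQ g (mem_linIso_of_mem_idComp hg)) (hfix g hg)
    exact hlt.not_ge (dimH_mono (Set.image_mono hsub))
end
end

section
/- Let F be a non-Euclidean (α,β)-norm on a real vector space V with dim V > 2. Then F admits at most two normalized data, and in any normalized datum (φ,α,β) of F, both α and β are invariant under the action of every element of L₀(V,F). -/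
noncomputable section

open Module Topology

namespace IsMinkowskiNorm

variable {V : Type*} [NormedAddCommGroup V] [NormedSpace ℝ V] {F : V → ℝ}

theorem map_zero (hF : IsMinkowskiNorm F) : F 0 = 0 := by
  have h := hF.homog 2 (by norm_num) 0
  rw [smul_zero] at h
  linarith

theorem isCompact_closedUnitBall [FiniteDimensional ℝ V] (hF : IsMinkowskiNorm F) :
    IsCompact {x | F x ≤ 1} := by
  have := FiniteDimensional.proper ℝ V
  refine Metric.isCompact_of_isClosed_isBounded
    (isClosed_le hF.continuous continuous_const) ?_
  rcases (Metric.sphere (0 : V) 1).eq_empty_or_nonempty with hS | hS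
  · have hsub : ∀ x : V, x = 0 := by
      intro x
      by_contra hx
      have : (‖x‖⁻¹ • x) ∈ Metric.sphere (0 : V) 1 := by
        simp [norm_smul, inv_mul_cancel₀ (norm_ne_zero_iff.mpr hx)]
      simp [hS] at this
    exact Bornology.IsBounded.subset (Bornology.isBounded_singleton (x := (0 : V)))
      fun x _ => hsub x
  · obtain ⟨z, hz, hmin⟩ := (isCompact_sphere (0 : V) 1).exists_isMinOn hS
      hF.continuous.continuousOn
    have hz0 : z ≠ 0 := by
      rintro rfl
      simp at hz
    have hm := hF.pos z hz0
    refine (Metric.isBounded_closedBall (x := (0 : V)) (r := (F z)⁻¹)).subset ?_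
    intro x hx
    rw [mem_closedBall_zero_iff]
    rcases eq_or_ne x 0 with rfl | hx0
    · simpa using hm.le
    have hn := norm_pos_iff.mpr hx0
    have hxs : (‖x‖⁻¹ • x) ∈ Metric.sphere (0 : V) 1 := by
      simp [norm_smul, inv_mul_cancel₀ hn.ne']
    have h1 := hmin hxs
    simp only [Set.mem_ofPred_eq] at h1
    rw [hF.homog _ (inv_pos.mpr hn)] at h1
    have h2 : F z * ‖x‖ ≤ 1 := by
      calc F z * ‖x‖ ≤ (‖x‖⁻¹ * F x) * ‖x‖ := by gcongr
        _ = F x := by field_simp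
        _ ≤ 1 := hx
    rw [inv_eq_one_div, le_div_iff₀ hm]
    linarith

theorem ker_eq_bot_of_isometry (hF : IsMinkowskiNorm F) {A : V →ₗ[ℝ] V}
    (hA : ∀ y, F (A y) = F y) : A.ker = ⊥ := by
  rw [LinearMap.ker_eq_bot']
  intro y hy
  by_contra hy0
  have := hF.pos y hy0
  rw [← hA, hy, hF.map_zero] at this
  exact lt_irrefl _ this

open MeasureTheory in
theorem map_addHaar_of_isometry [FiniteDimensional ℝ V] [MeasurableSpace V] [BorelSpace V]
    (hF : IsMinkowskiNorm F) (μ : Measure V) [μ.IsAddHaarMeasure] {A : V →ₗ[ℝ] V}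
    (hA : ∀ y, F (A y) = F y) : Measure.map A μ = μ := by
  have hdet : LinearMap.det A ≠ 0 := (A.isUnit_det
    ((LinearMap.isUnit_iff_ker_eq_bot A).mpr (hF.ker_eq_bot_of_isometry hA))).ne_zero
  have hpre : A ⁻¹' {x | F x ≤ 1} = {x | F x ≤ 1} := by
    ext x
    simp [hA]
  have hpos : μ {x | F x ≤ 1} ≠ 0 := by
    have ho : IsOpen {x | F x < 1} := isOpen_lt hF.continuous continuous_const
    have hp : 0 < μ {x | F x < 1} := ho.measure_pos μ ⟨0, by simp [hF.map_zero]⟩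
    have hle : μ {x | F x < 1} ≤ μ {x | F x ≤ 1} :=
      measure_mono fun x (hx : F x < 1) => show F x ≤ 1 from hx.le
    exact (hp.trans_le hle).ne'
  have hone : ENNReal.ofReal |(LinearMap.det A)⁻¹| = 1 := by
    have h := Measure.addHaar_preimage_linearMap μ hdet {x | F x ≤ 1}
    rw [hpre] at h
    exact (ENNReal.mul_eq_right hpos hF.isCompact_closedUnitBall.measure_lt_top.ne).mp h.symm
  rw [Measure.map_linearMap_addHaar_eq_smul_addHaar μ hdet, hone, one_smul]

open MeasureTheory in
/-- The second moments of linear forms over the unit ball of `F` form an inner product on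
the dual space that is invariant under all linear isometries of `F`. -/
theorem exists_invariant_dual_inner [FiniteDimensional ℝ V] (hF : IsMinkowskiNorm F) :
    ∃ g : Dual ℝ V →ₗ[ℝ] Dual ℝ V →ₗ[ℝ] ℝ, IsPosDefSymm g ∧
      ∀ A : V →ₗ[ℝ] V, (∀ y, F (A y) = F y) →
        ∀ ξ η : Dual ℝ V, g (ξ ∘ₗ A) (η ∘ₗ A) = g ξ η := by
  borelize V
  have := FiniteDimensional.proper ℝ V
  let μ : Measure V := Measure.addHaar
  have hc : ∀ ξ : Dual ℝ V, Continuous ξ := fun ξ => ξ.continuous_of_finiteDimensional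
  have hK := hF.isCompact_closedUnitBall
  have hint : ∀ ξ η : Dual ℝ V, IntegrableOn (fun x => ξ x * η x) {x | F x ≤ 1} μ :=
    fun ξ η => ((hc ξ).mul (hc η)).continuousOn.integrableOn_compact hK
  refine ⟨LinearMap.mk₂ ℝ (fun ξ η => ∫ x in {x | F x ≤ 1}, ξ x * η x ∂μ)
    ?_ ?_ ?_ ?_, ⟨?_, ?_⟩, ?_⟩
  · intro ξ ξ' η
    rw [← integral_add (hint _ _) (hint _ _)]
    simp [add_mul]
  · intro c ξ η
    rw [smul_eq_mul, ← integral_const_mul]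
    simp [mul_assoc]
  · intro ξ η η'
    rw [← integral_add (hint _ _) (hint _ _)]
    simp [mul_add]
  · intro c ξ η
    rw [smul_eq_mul, ← integral_const_mul]
    simp [mul_left_comm]
  · intro ξ η
    simp [mul_comm]
  · intro ξ hξ
    simp only [LinearMap.mk₂_apply]
    rw [setIntegral_pos_iff_support_of_nonneg_ae
      (Filter.Eventually.of_forall fun x => mul_self_nonneg _) (hint ξ ξ)]
    have ho : IsOpen ({x | ξ x ≠ 0} ∩ {x | F x < 1}) :=
      (isOpen_ne_fun (hc ξ) continuous_const).inter
        (isOpen_lt hF.continuous continuous_const)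
    have hne : ({x | ξ x ≠ 0} ∩ {x | F x < 1}).Nonempty := by
      obtain ⟨x, hx⟩ : ∃ x, ξ x ≠ 0 := by
        by_contra! h
        exact hξ (LinearMap.ext h)
      have hx0 : x ≠ 0 := by
        rintro rfl
        simp at hx
      have hp := hF.pos x hx0
      refine ⟨(2 * F x)⁻¹ • x, ?_, ?_⟩
      · simp [hx, hp.ne']
      · simp only [Set.mem_ofPred_eq]
        rw [hF.homog _ (by positivity)]
        field_simp
        norm_num
    refine (ho.measure_pos μ hne).trans_le (measure_mono ?_)
    rintro x ⟨hx, hx'⟩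
    exact ⟨mul_ne_zero hx hx, show F x ≤ 1 from le_of_lt hx'⟩
  · intro A hA ξ η
    have hmap := hF.map_addHaar_of_isometry μ hA
    have hpre : A ⁻¹' {x | F x ≤ 1} = {x | F x ≤ 1} := by
      ext x
      simp [hA]
    have h := setIntegral_map (μ := μ) (g := A) (f := fun x => ξ x * η x)
      (s := {x | F x ≤ 1}) hK.measurableSet
      ((hc ξ).mul (hc η)).aestronglyMeasurable
      A.continuous_of_finiteDimensional.measurable.aemeasurable
    rw [hmap, hpre] at h
    simpa using h.symm

/-- There is an inner product on `V` invariant under all linear isometries of `F`. -/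
theorem exists_invariant_inner [FiniteDimensional ℝ V] (hF : IsMinkowskiNorm F) :
    ∃ h : V →ₗ[ℝ] V →ₗ[ℝ] ℝ, IsPosDefSymm h ∧
      ∀ A : V →ₗ[ℝ] V, (∀ y, F (A y) = F y) → ∀ x y, h (A x) (A y) = h x y := by
  obtain ⟨g, ⟨gsymm, gpos⟩, ginv⟩ := hF.exists_invariant_dual_inner
  have ginj : Function.Injective g := by
    rw [← LinearMap.ker_eq_bot, LinearMap.ker_eq_bot']
    intro ξ hξ
    by_contra h0
    have := gpos ξ h0
    simp [hξ] at this
  let G := LinearMap.linearEquivOfInjective g ginj Subspace.dual_finrank_eq.symm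
  let h : V →ₗ[ℝ] V →ₗ[ℝ] ℝ := G.symm.toLinearMap ∘ₗ (Module.evalEquiv ℝ V).toLinearMap
  have key : ∀ x (ξ : Dual ℝ V), g (h x) ξ = ξ x := by
    intro x ξ
    have : G (h x) = Module.evalEquiv ℝ V x := by simp [h]
    have h2 : g (h x) = Module.evalEquiv ℝ V x := by
      rw [← this]
      rfl
    simp [h2]
  have hinj : ∀ x, h x = 0 → x = 0 := by
    intro x hx
    have : Module.evalEquiv ℝ V x = 0 := by
      simpa [h] using hx
    exact (Module.evalEquiv ℝ V).map_eq_zero_iff.mp this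
  refine ⟨h, ⟨fun x y => ?_, fun x hx => ?_⟩, fun A hA x y => ?_⟩
  · rw [← key x (h y), ← key y (h x), gsymm]
  · have := gpos (h x) fun h0 => hx (hinj x h0)
    rwa [key] at this
  · have hs : h (A x) ∘ₗ A = h x := by
      apply ginj
      ext ξ
      let e := LinearEquiv.ofInjectiveEndo A (LinearMap.ker_eq_bot.mp (hF.ker_eq_bot_of_isometry hA))
      have hξ : ξ = (ξ ∘ₗ e.symm.toLinearMap) ∘ₗ A := by
        ext z
        have : e.symm (A z) = z := e.symm_apply_apply z
        simp [this]
      rw [hξ, ginv A hA, key, key]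
      rfl
    exact LinearMap.congr_fun hs y

end IsMinkowskiNorm

namespace IsPosDefSymm

variable {V : Type*} [AddCommGroup V] [Module ℝ V] {h : V →ₗ[ℝ] V →ₗ[ℝ] ℝ}

theorem self_nonneg (hh : IsPosDefSymm h) (x : V) : 0 ≤ h x x := by
  rcases eq_or_ne x 0 with rfl | hx
  · simp
  · exact (hh.2 x hx).le

theorem eq_zero_of_self (hh : IsPosDefSymm h) {x : V} (hx : h x x = 0) : x = 0 := by
  by_contra h0
  exact (hh.2 x h0).ne' hx

/-- The normalization of a nonzero vector. -/
theorem unit_self (hh : IsPosDefSymm h) {x : V} (hx : x ≠ 0) :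
    h ((√(h x x))⁻¹ • x) ((√(h x x))⁻¹ • x) = 1 := by
  have hp := hh.2 x hx
  have hs := Real.mul_self_sqrt hp.le
  have hs0 := (Real.sqrt_pos.mpr hp).ne'
  simp only [map_smul, LinearMap.smul_apply, smul_eq_mul]
  field_simp
  nlinarith

theorem ext_self {h' : V →ₗ[ℝ] V →ₗ[ℝ] ℝ} (hh : IsPosDefSymm h) (hh' : IsPosDefSymm h')
    (H : ∀ x, h x x = h' x x) : h = h' := by
  ext x y
  have h1 := H (x + y)
  simp only [map_add, LinearMap.add_apply] at h1
  have := H x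
  have := H y
  have := hh.1 x y
  have := hh'.1 x y
  linarith

theorem exists_unit_orthogonal [FiniteDimensional ℝ V] (hh : IsPosDefSymm h)
    (hdim : 2 < finrank ℝ V) (ξ η : V →ₗ[ℝ] ℝ) : ∃ g, h g g = 1 ∧ ξ g = 0 ∧ η g = 0 := by
  have hk : (ξ.prod η).ker ≠ ⊥ :=
    LinearMap.ker_ne_bot_of_finrank_lt (by simpa using hdim)
  obtain ⟨g, hg, hg0⟩ := Submodule.exists_mem_ne_zero_of_ne_bot hk
  have hg' : (ξ g, η g) = (0, 0) := hg
  obtain ⟨hξ, hη⟩ := Prod.mk.inj hg'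
  exact ⟨_, hh.unit_self hg0, by simp [hξ], by simp [hη]⟩

end IsPosDefSymm

/-- A function that is constant on the parallels of the unit sphere of `h` with respect to
each of two different axes is constant on that sphere. -/
theorem IsPosDefSymm.eq_on_sphere_of_two_axes {V : Type*} [NormedAddCommGroup V]
    [NormedSpace ℝ V] [FiniteDimensional ℝ V] {h : V →ₗ[ℝ] V →ₗ[ℝ] ℝ}
    (hh : IsPosDefSymm h) (hdim : 2 < finrank ℝ V) {F : V → ℝ} (hF : Continuous F)
    {e f : V} {c s : ℝ} (he : h e e = 1) (hf : h f f = 1) (hef : h e f = 0) (hs : s ≠ 0)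
    (H₁ : ∀ x y, h x x = h y y → h x e = h y e → F x = F y)
    (H₂ : ∀ x y, h x x = h y y → h x (c • e + s • f) = h y (c • e + s • f) → F x = F y)
    {x y : V} (hx : h x x = 1) (hy : h y y = 1) : F x = F y := by
  obtain ⟨g, hg, heg, hfg⟩ := hh.exists_unit_orthogonal hdim (h e) (h f)
  have hfe : h f e = 0 := by rw [hh.1, hef]
  have hge : h g e = 0 := by rw [hh.1, heg]
  have hgf : h g f = 0 := by rw [hh.1, hfg]
  let ψ : ℝ → ℝ := fun t => F (t • e + √(1 - t ^ 2) • g)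
  have hψc : Continuous ψ := by fun_prop
  have hloc : ∀ t₀ ∈ Set.Ioo (-1 : ℝ) 1, ψ =ᶠ[𝓝 t₀] fun _ => ψ t₀ := by
    intro t₀ ht₀
    have hpos : 0 < 1 - t₀ ^ 2 := by nlinarith [ht₀.1, ht₀.2]
    have ho : IsOpen {t : ℝ | ((t₀ - t) * c / s) ^ 2 < 1 - t ^ 2} :=
      isOpen_lt (by fun_prop) (by fun_prop)
    have hmem : t₀ ∈ {t : ℝ | ((t₀ - t) * c / s) ^ 2 < 1 - t ^ 2} := by
      simpa using hpos
    filter_upwards [ho.mem_nhds hmem] with t ht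
    have ht : ((t₀ - t) * c / s) ^ 2 < 1 - t ^ 2 := ht
    set k := (t₀ - t) * c / s with hk
    have hks : k * s = (t₀ - t) * c := by rw [hk]; field_simp
    have h1 : √(1 - t ^ 2) ^ 2 = 1 - t ^ 2 :=
      Real.sq_sqrt (by nlinarith [sq_nonneg k])
    have h2 : √(1 - t₀ ^ 2) ^ 2 = 1 - t₀ ^ 2 := Real.sq_sqrt hpos.le
    have h3 : √(1 - t ^ 2 - k ^ 2) ^ 2 = 1 - t ^ 2 - k ^ 2 := Real.sq_sqrt (by linarith)
    calc ψ t = F (t • e + k • f + √(1 - t ^ 2 - k ^ 2) • g) := by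
          apply H₁ <;> simp [he, hf, hg, hef, heg, hfg, hfe, hge, hgf]
          nlinarith
      _ = ψ t₀ := by
          apply H₂ <;> simp [he, hf, hg, hef, heg, hfg, hfe, hge, hgf]
          · nlinarith
          · linarith
  have hconst : Set.EqOn ψ (fun _ => ψ 0) (Set.Ioo (-1) 1) := by
    intro t ht
    refine isOpen_Ioo.is_const_of_deriv_eq_zero isPreconnected_Ioo ?_ ?_ ht (by norm_num)
    · intro u hu
      exact ((differentiableAt_const _).congr_of_eventuallyEq
        (hloc u hu)).differentiableWithinAt
    · intro u hu
      simp [(hloc u hu).deriv_eq]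
  have hconst' := hconst.closure hψc continuous_const
  rw [closure_Ioo (by norm_num)] at hconst'
  have main : ∀ z, h z z = 1 → F z = ψ 0 := by
    intro z hz
    have h0 := hh.self_nonneg (z - h z e • e)
    have hez := hh.1 e z
    simp [hz, he, hez] at h0
    have hsq : h z e ^ 2 ≤ 1 := by nlinarith
    have hmem : h z e ∈ Set.Icc (-1 : ℝ) 1 := by
      rw [Set.mem_Icc]; exact abs_le.mp ((sq_le_one_iff_abs_le_one _).mp hsq)
    refine Eq.trans ?_ (hconst' hmem)
    have h2 : √(1 - h z e ^ 2) ^ 2 = 1 - h z e ^ 2 := Real.sq_sqrt (by linarith)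
    apply H₁ <;> simp [he, hg, hge, heg, hz]
    nlinarith
  rw [main x hx, main y hy]

/-- An `(α,β)`-norm structure on `F`, normalized by a vector `e` dual to `β`. -/
structure IsAxisDatum {V : Type*} [AddCommGroup V] [Module ℝ V] (F : V → ℝ) (φ : ℝ → ℝ)
    (B : V →ₗ[ℝ] V →ₗ[ℝ] ℝ) (β : V →ₗ[ℝ] ℝ) (e : V) : Prop where
  inner : IsPosDefSymm B
  eq : ∀ y, y ≠ 0 → F y = alphaOf B y * φ (β y / alphaOf B y)
  ker : ∀ y, β y = 0 → B y y = F y ^ 2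
  dual : ∀ x, B e x = β x
  beta_axis : β e = 1
  norm_axis : F e = 1

namespace IsAxisDatum

variable {V : Type*} [NormedAddCommGroup V] [NormedSpace ℝ V] {F : V → ℝ} {φ φ' : ℝ → ℝ}
  {B B' h : V →ₗ[ℝ] V →ₗ[ℝ] ℝ} {β β' : V →ₗ[ℝ] ℝ} {e e' : V}

theorem axis_ne_zero (d : IsAxisDatum F φ B β e) : e ≠ 0 := by
  rintro rfl
  simpa using d.beta_axis

theorem map_eq (d : IsAxisDatum F φ B β e) {x y : V} (h₁ : B x x = B y y)
    (h₂ : β x = β y) : F x = F y := by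
  rcases eq_or_ne x 0 with rfl | hx
  · rw [d.inner.eq_zero_of_self (x := y) (by simpa using h₁.symm)]
  · have hy : y ≠ 0 := by
      rintro rfl
      exact hx (d.inner.eq_zero_of_self (by simpa using h₁))
    rw [d.eq x hx, d.eq y hy, alphaOf, alphaOf, h₁, h₂]

/-- A bilinear form invariant under the isometries of `F` is invariant under the
`B`-reflections along vectors of `ker β`. -/
theorem reflection (d : IsAxisDatum F φ B β e)
    (hinv : ∀ A : V →ₗ[ℝ] V, (∀ y, F (A y) = F y) → ∀ x y, h (A x) (A y) = h x y)
    {u : V} (hu : β u = 0) (hu0 : u ≠ 0) (x y : V) :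
    h (x - (2 * B u x / B u u) • u) (y - (2 * B u y / B u u) • u) = h x y := by
  have hp := (d.inner.2 u hu0).ne'
  let A : V →ₗ[ℝ] V := LinearMap.id - ((2 / B u u) • B u).smulRight u
  have hA : ∀ x, A x = x - (2 * B u x / B u u) • u := by
    intro x
    simp [A]
    ring_nf
  rw [← hA, ← hA]
  apply hinv
  intro z
  rw [hA]
  apply d.map_eq
  · have := d.inner.1 u z
    simp [this]
    field_simp
    ring
  · simp [hu]

theorem orthogonal (d : IsAxisDatum F φ B β e)
    (hinv : ∀ A : V →ₗ[ℝ] V, (∀ y, F (A y) = F y) → ∀ x y, h (A x) (A y) = h x y)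
    {u : V} (hu : β u = 0) : h e u = 0 := by
  rcases eq_or_ne u 0 with rfl | hu0
  · simp
  have h1 := d.reflection hinv hu hu0 e u
  have hp := (d.inner.2 u hu0).ne'
  have h2 : B u e = 0 := by rw [d.inner.1, d.dual, hu]
  rw [h2, mul_div_assoc 2 (B u u), div_self hp] at h1
  simp at h1
  linarith

theorem inner_axis (d : IsAxisDatum F φ B β e)
    (hinv : ∀ A : V →ₗ[ℝ] V, (∀ y, F (A y) = F y) → ∀ x y, h (A x) (A y) = h x y)
    (x : V) : h e x = β x * h e e := by
  have h1 := d.orthogonal hinv (u := x - β x • e) (by simp [d.beta_axis])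
  simp at h1
  linarith

theorem inner_eq_of_ker (d : IsAxisDatum F φ B β e)
    (hinv : ∀ A : V →ₗ[ℝ] V, (∀ y, F (A y) = F y) → ∀ x y, h (A x) (A y) = h x y)
    {u v : V} (hu : β u = 0) (hv : β v = 0) (huv : B u u = B v v) : h u u = h v v := by
  rcases eq_or_ne u v with rfl | hne
  · rfl
  have hne' := sub_ne_zero.mpr hne
  have hp := (d.inner.2 _ hne').ne'
  have h1 := d.reflection hinv (u := u - v) (by simp [hu, hv]) hne' u u
  have h2 : 2 * B (u - v) u / B (u - v) (u - v) = 1 := by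
    rw [div_eq_one_iff_eq hp]
    have := d.inner.1 u v
    simp
    linarith
  rw [h2] at h1
  simpa using h1.symm

theorem axis_inner_eq_of_ker (d : IsAxisDatum F φ B β e) (hh : IsPosDefSymm h)
    (hinv : ∀ A : V →ₗ[ℝ] V, (∀ y, F (A y) = F y) → ∀ x y, h (A x) (A y) = h x y)
    {u v : V} (hu : β u = 0) (hv : β v = 0) (huv : h u u = h v v) : B u u = B v v := by
  rcases eq_or_ne v 0 with rfl | hv0
  · rw [hh.eq_zero_of_self (x := u) (by simpa using huv)]
  have hpB := d.inner.2 v hv0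
  have hph := hh.2 v hv0
  set t := √(B u u / B v v) with ht
  have ht2 : t ^ 2 = B u u / B v v := Real.sq_sqrt (div_nonneg (d.inner.self_nonneg u) hpB.le)
  have h1 := d.inner_eq_of_ker hinv (u := u) (v := t • v) hu (by simp [hv])
    (by simp; rw [← mul_assoc, ← sq, ht2]; field_simp)
  simp at h1
  rw [huv, ← mul_assoc, ← sq, ht2] at h1
  have h2 : B u u / B v v = 1 := by
    have := hph.ne'
    field_simp at h1
    rw [div_eq_one_iff_eq hpB.ne']
    linarith
  rwa [div_eq_one_iff_eq hpB.ne'] at h2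

theorem inner_self (d : IsAxisDatum F φ B β e) (x : V) :
    B x x = F (x - β x • e) ^ 2 + β x ^ 2 := by
  have h1 := d.ker (x - β x • e) (by simp [d.beta_axis])
  have hs := d.inner.1 e x
  have h4 := d.dual e
  rw [d.beta_axis] at h4
  simp [h4] at h1
  simp only [← d.dual]
  rw [← d.dual, ← hs] at h1
  nlinarith

/-- `F` is constant on the parallels, with respect to the axis `e`, of an invariant inner
product. -/
theorem map_eq_of_inner (d : IsAxisDatum F φ B β e) (hh : IsPosDefSymm h)
    (hinv : ∀ A : V →ₗ[ℝ] V, (∀ y, F (A y) = F y) → ∀ x y, h (A x) (A y) = h x y)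
    {x y : V} (h₁ : h x x = h y y) (h₂ : h x e = h y e) : F x = F y := by
  have hp := hh.2 e d.axis_ne_zero
  have hax := d.inner_axis hinv
  have hβ : β x = β y := by
    rw [hh.1 x, hh.1 y, hax x, hax y] at h₂
    exact mul_right_cancel₀ hp.ne' h₂
  refine d.map_eq ?_ hβ
  have h3 := d.axis_inner_eq_of_ker hh hinv (u := x - β x • e) (v := y - β y • e)
    (by simp [d.beta_axis]) (by simp [d.beta_axis])
    (by simp [hh.1 x e, hh.1 y e, hax x, hax y, h₁, hβ])
  rw [d.ker _ (by simp [d.beta_axis]), d.ker _ (by simp [d.beta_axis])] at h3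
  rw [d.inner_self x, d.inner_self y, h3, hβ]

/-- The axes of two normalized data of a non-Euclidean norm are parallel. -/
theorem axis_parallel [FiniteDimensional ℝ V] (d : IsAxisDatum F φ B β e)
    (d' : IsAxisDatum F φ' B' β' e') (hdim : 2 < finrank ℝ V) (hF : IsMinkowskiNorm F)
    (hnonE : ¬ IsEuclideanNorm F) : ∃ k : ℝ, e' = k • e ∧ ∀ x, β x = k * β' x := by
  obtain ⟨h, hh, hinv⟩ := hF.exists_invariant_inner
  have hp := hh.2 e d.axis_ne_zero
  have hp' := hh.2 e' d'.axis_ne_zero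
  have hax := d.inner_axis hinv
  have hax' := d'.inner_axis hinv
  by_cases hpar : e' = β e' • e
  · set k := β e' with hk
    have hk0 : k ≠ 0 := by
      rintro h0
      rw [h0, zero_smul] at hpar
      exact d'.axis_ne_zero hpar
    refine ⟨k, hpar, fun x => ?_⟩
    have h1 := hax' x
    rw [hpar] at h1
    simp [hax x] at h1
    have := hp.ne'
    field_simp at h1
    linarith
  · exfalso
    apply hnonE
    have hv0 := sub_ne_zero.mpr hpar
    set v := e' - β e' • e with hv
    have hev : h e v = 0 := by
      simp only [hv, map_sub, map_smul, smul_eq_mul, hax e', sub_self]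
    set a := √(h e e)
    set b := √(h v v)
    have ha : 0 < a := Real.sqrt_pos.mpr hp
    have hb : 0 < b := Real.sqrt_pos.mpr (hh.2 v hv0)
    have hsph : ∀ x y, h x x = 1 → h y y = 1 → F x = F y := by
      intro x y hx hy
      have he' : (β e' * a) • (a⁻¹ • e) + b • (b⁻¹ • v) = e' := by
        rw [smul_smul, smul_smul, mul_assoc, mul_inv_cancel₀ ha.ne', mul_inv_cancel₀ hb.ne',
          hv]
        simp
      refine hh.eq_on_sphere_of_two_axes hdim hF.continuous (e := a⁻¹ • e) (f := b⁻¹ • v)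
        (c := β e' * a) (s := b) (hh.unit_self d.axis_ne_zero) (hh.unit_self hv0)
        (by simp [hev]) hb.ne' (fun x y h₁ h₂ => d.map_eq_of_inner hh hinv h₁ ?_)
        (fun x y h₁ h₂ => d'.map_eq_of_inner hh hinv h₁ ?_) hx hy
      · simpa [ha.ne'] using h₂
      · rwa [he'] at h₂
    set x₀ := a⁻¹ • e
    have hx₀ : h x₀ x₀ = 1 := hh.unit_self d.axis_ne_zero
    have hc : 0 < F x₀ := hF.pos _ (by rintro h0; simp [h0] at hx₀)
    refine ⟨F x₀ ^ 2 • h, ⟨fun x y => by simp [hh.1 x y], fun x hx => ?_⟩, fun y => ?_⟩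
    · have := hh.2 x hx
      simp only [LinearMap.smul_apply, smul_eq_mul]
      positivity
    · rcases eq_or_ne y 0 with rfl | hy
      · simp [hF.map_zero]
      have h1 := hsph _ _ (hh.unit_self hy) hx₀
      have hy' := hh.2 y hy
      rw [hF.homog _ (inv_pos.mpr (Real.sqrt_pos.mpr hy')),
        inv_mul_eq_iff_eq_mul₀ (Real.sqrt_pos.mpr hy').ne'] at h1
      rw [h1, mul_pow, Real.sq_sqrt hy'.le]
      simp [mul_comm]

/-- Data with positively proportional axes coincide. -/
theorem eq_of_pos_smul (d : IsAxisDatum F φ B β e)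
    (d' : IsAxisDatum F φ' B' β' e') (hF : IsMinkowskiNorm F) {k : ℝ} (hk : 0 < k)
    (he : e' = k • e) (hβ : ∀ x, β x = k * β' x) : B = B' ∧ β = β' ∧ e = e' := by
  have h1 := d'.norm_axis
  rw [he, hF.homog k hk, d.norm_axis, mul_one] at h1
  have he' : e = e' := by simp [he, h1]
  have hb : β = β' := by
    ext x
    simp [hβ, h1]
  refine ⟨d.inner.ext_self d'.inner fun x => ?_, hb, he'⟩
  rw [d.inner_self, d'.inner_self, hb, he']

theorem eqOn [FiniteDimensional ℝ V] (d : IsAxisDatum F φ B β e)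
    (d' : IsAxisDatum F φ' B β e') (hdim : 2 < finrank ℝ V) :
    Set.EqOn φ φ' (Set.Icc (-1) 1) := by
  intro s hs
  obtain ⟨u, hu, hβu, -⟩ := d.inner.exists_unit_orthogonal hdim β 0
  have hee : B e e = 1 := by rw [d.dual, d.beta_axis]
  have heu : B e u = 0 := by rw [d.dual, hβu]
  have hue : B u e = 0 := by rw [d.inner.1, heu]
  have h2 : √(1 - s ^ 2) ^ 2 = 1 - s ^ 2 := Real.sq_sqrt (by nlinarith [hs.1, hs.2])
  set y := s • e + √(1 - s ^ 2) • u with hy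
  have hyy : B y y = 1 := by
    simp [hy, hee, heu, hue, hu]
    nlinarith
  have hβy : β y = s := by simp [hy, d.beta_axis, hβu]
  have hy0 : y ≠ 0 := by
    rintro h0
    simp [h0] at hyy
  have h3 := d.eq y hy0
  rw [d'.eq y hy0] at h3
  simpa [alphaOf, hyy, hβy] using h3.symm

/-- The pullback of a datum along a linear isometry. -/
theorem comp (d : IsAxisDatum F φ B β e) (A : V ≃ₗ[ℝ] V) (hA : ∀ y, F (A y) = F y) :
    IsAxisDatum F φ (B.compl₁₂ A.toLinearMap A.toLinearMap) (β ∘ₗ A.toLinearMap)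
      (A.symm e) where
  inner := ⟨fun x y => d.inner.1 _ _, fun x hx => d.inner.2 _ (by simpa using hx)⟩
  eq y hy := by
    rw [← hA, d.eq (A y) (by simpa using hy)]
    rfl
  ker y hy := by
    rw [← hA]
    exact d.ker _ hy
  dual x := by simp [d.dual]
  beta_axis := by simp [d.beta_axis]
  norm_axis := by rw [← hA]; simp [d.norm_axis]

end IsAxisDatum

theorem IsNormalizedDatum.exists_isAxisDatum {V : Type*} [NormedAddCommGroup V]
    [NormedSpace ℝ V] [FiniteDimensional ℝ V] {F : V → ℝ} {φ : ℝ → ℝ}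
    {B : V →ₗ[ℝ] V →ₗ[ℝ] ℝ} {β : V →ₗ[ℝ] ℝ} (d : IsNormalizedDatum F φ B β)
    (hnonE : ¬ IsEuclideanNorm F) : ∃ e, IsAxisDatum F φ B β e := by
  obtain ⟨⟨hB, -, -, heq⟩, hker, hax⟩ := d
  have hker' : ∀ y, β y = 0 → B y y = F y ^ 2 := by
    intro y hy
    rw [← hker y hy, alphaOf, Real.sq_sqrt (hB.self_nonneg y)]
  have hinj : Function.Injective B := by
    rw [← LinearMap.ker_eq_bot, LinearMap.ker_eq_bot']
    intro x hx
    exact hB.eq_zero_of_self (by simp [hx])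
  obtain ⟨e, he⟩ := (LinearMap.injective_iff_surjective_of_finrank_eq_finrank
    Subspace.dual_finrank_eq.symm).mp hinj β
  have he0 : e ≠ 0 := by
    rintro rfl
    refine hnonE ⟨B, hB, fun y => (hker' y ?_).symm⟩
    rw [← he]
    simp
  have hdual : ∀ x, B e x = β x := fun x => by rw [he]
  have hpos : 0 < β e := by
    rw [← hdual]
    exact hB.2 e he0
  obtain ⟨h1, h2⟩ := hax e (fun x hx => by rw [hdual, hx]) hpos
  have hone : β e = 1 := by
    have h3 : alphaOf B e ^ 2 = β e := by
      rw [alphaOf, Real.sq_sqrt (hB.self_nonneg e), hdual]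
    rw [h1] at h3
    nlinarith
  exact ⟨e, hB, heq, hker', hdual, hone, by rw [← h2, hone]⟩

namespace linIso

variable {V : Type*} [NormedAddCommGroup V] [NormedSpace ℝ V] {F : V → ℝ}

theorem apply_inv_apply (A : (V →L[ℝ] V)ˣ) (y : V) :
    (A : V →L[ℝ] V) (((A⁻¹ : (V →L[ℝ] V)ˣ) : V →L[ℝ] V) y) = y := by
  rw [← mul_apply_eq_comp, Units.mul_inv, one_apply_eq_self]

theorem inv_apply_apply (A : (V →L[ℝ] V)ˣ) (y : V) :
    ((A⁻¹ : (V →L[ℝ] V)ˣ) : V →L[ℝ] V) ((A : V →L[ℝ] V) y) = y := by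
  rw [← mul_apply_eq_comp, Units.inv_mul, one_apply_eq_self]

/-- A unit of the algebra of continuous endomorphisms as a linear equivalence. -/
def toLinearEquiv (A : (V →L[ℝ] V)ˣ) : V ≃ₗ[ℝ] V :=
  LinearEquiv.ofLinearMap ((A : V →L[ℝ] V) : V →ₗ[ℝ] V)
    (((A⁻¹ : (V →L[ℝ] V)ˣ) : V →L[ℝ] V) : V →ₗ[ℝ] V)
    (LinearMap.ext (apply_inv_apply A)) (LinearMap.ext (inv_apply_apply A))

/-- A linear form that never vanishes along the orbit `A⁻¹ e` stays positive on the identity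
component when it is positive at the identity. -/
theorem pos_of_mem_idComp [FiniteDimensional ℝ V] {β : V →ₗ[ℝ] ℝ} {e : V} (he : 0 < β e)
    (hne : ∀ A ∈ linIso F, β (((A⁻¹ : (V →L[ℝ] V)ˣ) : V →L[ℝ] V) e) ≠ 0)
    {A : (V →L[ℝ] V)ˣ} (hA : A ∈ idComp (linIso F)) :
    0 < β (((A⁻¹ : (V →L[ℝ] V)ˣ) : V →L[ℝ] V) e) := by
  obtain ⟨A, hA, rfl⟩ := hA
  let f : linIso F → ℝ := fun A => β ((((A : (V →L[ℝ] V)ˣ)⁻¹ : (V →L[ℝ] V)ˣ) : V →L[ℝ] V) e)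
  have hf : Continuous f := by
    refine β.continuous_of_finiteDimensional.comp ?_
    exact (Units.continuous_val.comp
      (continuous_inv.comp continuous_subtype_val)).clm_apply continuous_const
  by_contra! hle
  have h1 : f 1 = β e := by simp [f]
  obtain ⟨C, -, hC⟩ := isPreconnected_connectedComponent.intermediate_value hA
    mem_connectedComponent hf.continuousOn (show (0 : ℝ) ∈ Set.Icc (f A) (f 1) from
      ⟨hle, h1 ▸ he.le⟩)
  exact hne C C.2 hC

end linIso

/-- a non-Euclidean `(α,β)`-norm in dimension `> 2` admits at most two
normalized data, and in any normalized datum both `α` and `β` are invariant under every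
element of `L₀(V, F)`.  (Two data are counted as equal when their `φ`'s agree on `[-1,1]`
and their `α`'s and `β`'s coincide.) -/
theorem statement2 {V : Type*} [NormedAddCommGroup V] [NormedSpace ℝ V]
    [FiniteDimensional ℝ V] (hdim : 2 < finrank ℝ V)
    (F : V → ℝ) (hMink : IsMinkowskiNorm F) (hnonE : ¬ IsEuclideanNorm F)
    (hab : ∃ φ B β, IsAlphaBetaDatum F φ B β) :
    (∀ d₁ d₂ d₃ : (ℝ → ℝ) × (V →ₗ[ℝ] V →ₗ[ℝ] ℝ) × (V →ₗ[ℝ] ℝ),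
        IsNormalizedDatum F d₁.1 d₁.2.1 d₁.2.2 →
        IsNormalizedDatum F d₂.1 d₂.2.1 d₂.2.2 →
        IsNormalizedDatum F d₃.1 d₃.2.1 d₃.2.2 →
        (Set.EqOn d₁.1 d₂.1 (Set.Icc (-1 : ℝ) 1) ∧ d₁.2 = d₂.2) ∨
        (Set.EqOn d₁.1 d₃.1 (Set.Icc (-1 : ℝ) 1) ∧ d₁.2 = d₃.2) ∨
        (Set.EqOn d₂.1 d₃.1 (Set.Icc (-1 : ℝ) 1) ∧ d₂.2 = d₃.2)) ∧
    (∀ φ B β, IsNormalizedDatum F φ B β → ∀ A ∈ idComp (linIso F),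
        (∀ y, alphaOf B ((A : V →L[ℝ] V) y) = alphaOf B y) ∧
        ∀ y, β ((A : V →L[ℝ] V) y) = β y) := by
  refine ⟨?_, ?_⟩
  · rintro ⟨φ₁, B₁, β₁⟩ ⟨φ₂, B₂, β₂⟩ ⟨φ₃, B₃, β₃⟩ h₁ h₂ h₃
    obtain ⟨e₁, d₁⟩ := h₁.exists_isAxisDatum hnonE
    obtain ⟨e₂, d₂⟩ := h₂.exists_isAxisDatum hnonE
    obtain ⟨e₃, d₃⟩ := h₃.exists_isAxisDatum hnonE
    obtain ⟨k, hk, hkβ⟩ := d₁.axis_parallel d₂ hdim hMink hnonE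
    obtain ⟨l, hl, hlβ⟩ := d₁.axis_parallel d₃ hdim hMink hnonE
    obtain ⟨m, hm, hmβ⟩ := d₂.axis_parallel d₃ hdim hMink hnonE
    have hklm : l = k * m := by
      have h := hlβ e₃
      rw [hkβ, hmβ, d₃.beta_axis] at h
      linarith
    have hl0 : l ≠ 0 := by
      rintro rfl
      exact d₃.axis_ne_zero (by simpa using hl)
    rcases lt_or_ge 0 k with hk0 | hk0
    · obtain ⟨rfl, rfl, -⟩ := d₁.eq_of_pos_smul d₂ hMink hk0 hk hkβ
      exact Or.inl ⟨d₁.eqOn d₂ hdim, rfl⟩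
    rcases lt_or_ge 0 m with hm0 | hm0
    · obtain ⟨rfl, rfl, -⟩ := d₂.eq_of_pos_smul d₃ hMink hm0 hm hmβ
      exact Or.inr (Or.inr ⟨d₂.eqOn d₃ hdim, rfl⟩)
    have hl1 : 0 < l :=
      lt_of_le_of_ne (hklm ▸ mul_nonneg_of_nonpos_of_nonpos hk0 hm0) hl0.symm
    obtain ⟨rfl, rfl, -⟩ := d₁.eq_of_pos_smul d₃ hMink hl1 hl hlβ
    exact Or.inr (Or.inl ⟨d₁.eqOn d₃ hdim, rfl⟩)
  · intro φ B β hd A hA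
    obtain ⟨e, d⟩ := hd.exists_isAxisDatum hnonE
    have hpar : ∀ C ∈ linIso F, ∃ k : ℝ, ((C⁻¹ : (V →L[ℝ] V)ˣ) : V →L[ℝ] V) e = k • e ∧
        ∀ x, β x = k * β ((C : V →L[ℝ] V) x) := fun C hC =>
      d.axis_parallel (d.comp (linIso.toLinearEquiv C) hC) hdim hMink hnonE
    have hpos := linIso.pos_of_mem_idComp (F := F) (β := β) (e := e)
      (by rw [d.beta_axis]; exact one_pos) (fun C hC h0 => ?_) hA
    · have hAF : A ∈ linIso F := by
        obtain ⟨C, -, rfl⟩ := hA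
        exact C.2
      obtain ⟨k, hk, hkβ⟩ := hpar A hAF
      have hk0 : 0 < k := by
        rw [hk] at hpos
        simpa [d.beta_axis] using hpos
      obtain ⟨hB, hβ, -⟩ := d.eq_of_pos_smul (d.comp (linIso.toLinearEquiv A) hAF) hMink hk0
        hk hkβ
      refine ⟨fun y => ?_, fun y => (LinearMap.congr_fun hβ y).symm⟩
      exact congrArg Real.sqrt (LinearMap.congr_fun₂ hB y y).symm
    · obtain ⟨k, hk, -⟩ := hpar C hC
      have h1 : β (((C⁻¹ : (V →L[ℝ] V)ˣ) : V →L[ℝ] V) e) = k := by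
        rw [hk]
        simp [d.beta_axis]
      rw [h1] at h0
      rw [h0, zero_smul] at hk
      have h2 := linIso.apply_inv_apply C e
      rw [hk, map_zero] at h2
      exact d.axis_ne_zero h2.symm
end
end

section
/- Let F be a non-Euclidean (α,β)-norm on a real vector space V with dim V = n > 2, given by a normalized datum (φ,α,β) in which φ ∈ C^∞([−1,1]) is real analytic on the open interval (−1,1). Suppose there is a linear subspace V' ⊆ V with dim V' = m > 1 such that V' is not contained in ker β and such that the restriction of F to V' is a Randers norm. Then F itself is a Randers norm on V. -/
noncomputable section

open Module Topology

/-- A Randers norm: a Minkowski norm of the form `α' + β'` with `α'` the norm of an inner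
product and `β'` a linear form of `α'`-norm less than one. -/
def IsRandersNorm {W : Type*} [NormedAddCommGroup W] [NormedSpace ℝ W] (F : W → ℝ) :
    Prop :=
  IsMinkowskiNorm F ∧ ∃ (B' : W →ₗ[ℝ] W →ₗ[ℝ] ℝ) (β' : W →ₗ[ℝ] ℝ),
    IsPosDefSymm B' ∧ (∀ y, y ≠ 0 → |β' y| < alphaOf B' y) ∧
    ∀ y, F y = alphaOf B' y + β' y

/-- A function analytic on `(-1,1)`, continuous on `[-1,1]` and positive at `±1` that has the
Randers form `√(1 + k s²) + q s` near `0` has this form on `[-1,1]`, with `-1 < k`. -/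
theorem eqOn_randers_profile {φ : ℝ → ℝ} {k q : ℝ}
    (hcont : ContinuousOn φ (Set.Icc (-1 : ℝ) 1))
    (han : ∀ s ∈ Set.Ioo (-1 : ℝ) 1, AnalyticAt ℝ φ s)
    (hloc : ∀ᶠ s in 𝓝 (0 : ℝ), φ s = √(1 + k * s ^ 2) + q * s)
    (h_one : 0 < φ 1) (h_neg_one : 0 < φ (-1)) :
    -1 < k ∧ ∀ s ∈ Set.Icc (-1 : ℝ) 1, φ s = √(1 + k * s ^ 2) + q * s := by
  have hcl : Set.Icc (-1 : ℝ) 1 ⊆ closure (Set.Ioo (-1 : ℝ) 1) := by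
    rw [closure_Ioo (by norm_num)]
  have hsub : Set.Ioo (-1 : ℝ) 1 ⊆ Set.Icc (-1 : ℝ) 1 := Set.Ioo_subset_Icc_self
  have h0 : (0 : ℝ) ∈ Set.Ioo (-1 : ℝ) 1 := by constructor <;> norm_num
  have hψ : ContinuousOn (fun s => φ s - q * s) (Set.Icc (-1 : ℝ) 1) :=
    hcont.sub (by fun_prop)
  have hpos : ∀ᶠ s in 𝓝 (0 : ℝ), 0 < 1 + k * s ^ 2 := by
    have hc : ContinuousAt (fun s : ℝ => 1 + k * s ^ 2) 0 := by fun_prop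
    exact hc.eventually (lt_mem_nhds (by norm_num))
  have hsq : Set.EqOn (fun s => (φ s - q * s) ^ 2) (fun s => 1 + k * s ^ 2)
      (Set.Ioo (-1 : ℝ) 1) := by
    refine AnalyticOnNhd.eqOn_of_preconnected_of_eventuallyEq (𝕜 := ℝ)
      (fun s hs => ?_) (fun s _ => ?_)
      isPreconnected_Ioo h0 ?_
    · exact ((han s hs).sub (by fun_prop)).pow 2
    · fun_prop
    · filter_upwards [hloc, hpos] with s hs hp
      rw [hs, add_sub_cancel_right, Real.sq_sqrt hp.le]
  have hsq' : Set.EqOn (fun s => (φ s - q * s) ^ 2) (fun s => 1 + k * s ^ 2)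
      (Set.Icc (-1 : ℝ) 1) :=
    hsq.of_subset_closure (hψ.pow 2) (by fun_prop) hsub hcl
  have hk : -1 < k := by
    have h₁ := hsq' (show (1 : ℝ) ∈ Set.Icc (-1 : ℝ) 1 by constructor <;> norm_num)
    have h₂ := hsq' (show (-1 : ℝ) ∈ Set.Icc (-1 : ℝ) 1 by constructor <;> norm_num)
    simp only at h₁ h₂
    by_contra! hle
    have e₁ : φ 1 - q * 1 = 0 := by nlinarith [sq_nonneg (φ 1 - q * 1)]
    have e₂ : φ (-1) - q * (-1) = 0 := by nlinarith [sq_nonneg (φ (-1) - q * (-1))]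
    linarith
  have hpos' : ∀ s ∈ Set.Ioo (-1 : ℝ) 1, 0 < 1 + k * s ^ 2 := by
    rintro s ⟨hs, hs'⟩
    nlinarith [mul_pos (show 0 < 1 + s by linarith) (show 0 < 1 - s by linarith),
      mul_nonneg (show 0 ≤ 1 + k by linarith) (sq_nonneg s)]
  have heq : Set.EqOn (fun s => φ s - q * s) (fun s => √(1 + k * s ^ 2))
      (Set.Ioo (-1 : ℝ) 1) := by
    refine isPreconnected_Ioo.eq_of_sq_eq (hψ.mono hsub) (by fun_prop) (fun s hs => ?_)
      (fun {s} hs => (Real.sqrt_pos.2 (hpos' s hs)).ne') h0 ?_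
    · simpa [Real.sq_sqrt (hpos' s hs).le] using hsq hs
    · simp [hloc.self_of_nhds]
  refine ⟨hk, fun s hs => ?_⟩
  have := heq.of_subset_closure hψ (by fun_prop) hsub hcl hs
  simp only at this
  linarith

/-- Restricted to a plane on which `α² = a² + c b²` and `β = b`, an `(α,β)`-norm is even in `a`,
so a Randers form of the restriction determines `φ` near `0`. -/
theorem exists_randers_profile_of_plane {φ : ℝ → ℝ} {c P D E p q : ℝ}
    (hφ : φ 0 = 1)
    (hQ : ∀ a b, a ^ 2 + c * b ^ 2 = 1 → 0 ≤ P * a ^ 2 + 2 * D * (a * b) + E * b ^ 2)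
    (h : ∀ a b, a ^ 2 + c * b ^ 2 = 1 →
      φ b = √(P * a ^ 2 + 2 * D * (a * b) + E * b ^ 2) + (p * a + q * b)) :
    ∀ᶠ s in 𝓝 (0 : ℝ), φ s = √(1 + (E - c) * s ^ 2) + q * s := by
  have h₁ := h 1 0 (by norm_num)
  have h₂ := h (-1) 0 (by norm_num)
  norm_num [hφ] at h₁ h₂
  have hp : p = 0 := by linarith
  have hP : P = 1 := by
    rw [hp, add_zero, eq_comm, Real.sqrt_eq_one] at h₁
    exact h₁
  subst hp hP
  have hsmall : ∀ᶠ s in 𝓝 (0 : ℝ), 0 < 1 - c * s ^ 2 := by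
    have hc : ContinuousAt (fun s : ℝ => 1 - c * s ^ 2) 0 := by fun_prop
    exact hc.eventually (lt_mem_nhds (by norm_num))
  filter_upwards [hsmall] with s hs
  have hr : √(1 - c * s ^ 2) ^ 2 = 1 - c * s ^ 2 := Real.sq_sqrt hs.le
  have hrpos := Real.sqrt_pos.2 hs
  set r := √(1 - c * s ^ 2)
  have hplus : r ^ 2 + c * s ^ 2 = 1 := by linarith
  have hminus : (-r) ^ 2 + c * s ^ 2 = 1 := by linarith [neg_sq r]
  have e₁ := h r s hplus
  have e₂ := h (-r) s hminus
  have heq := (Real.sqrt_inj (hQ r s hplus) (hQ (-r) s hminus)).1 (by linarith)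
  have hD : 2 * D * (r * s) = 0 := by linarith [neg_sq r, neg_mul r s]
  rw [e₁, hD, hr]
  ring_nf

/-- The linear form of a normalized datum is represented by a vector of length one. -/
theorem IsNormalizedDatum.exists_dual_vector {V : Type*} [NormedAddCommGroup V]
    [NormedSpace ℝ V] [FiniteDimensional ℝ V] {F : V → ℝ} {φ : ℝ → ℝ}
    {B : V →ₗ[ℝ] V →ₗ[ℝ] ℝ} {β : V →ₗ[ℝ] ℝ} (h : IsNormalizedDatum F φ B β) (hβ : β ≠ 0) :
    ∃ v, B v = β ∧ β v = 1 := by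
  obtain ⟨⟨⟨-, hpd⟩, -⟩, -, hn⟩ := h
  have hinj : Function.Injective B := by
    rw [injective_iff_map_eq_zero]
    intro x hx
    by_contra hne
    simpa [hx] using hpd x hne
  have hsurj : Function.Surjective B :=
    (LinearMap.injective_iff_surjective_of_finrank_eq_finrank
      (Subspace.dual_finrank_eq (K := ℝ) (V := V)).symm).1 hinj
  obtain ⟨v, hv⟩ := hsurj β
  have hv0 : v ≠ 0 := by
    rintro rfl
    exact hβ (by simpa using hv.symm)
  have hpos : 0 < β v := by
    rw [← hv]
    exact hpd v hv0
  have hα := (hn v (fun x hx => by rw [hv, hx]) hpos).1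
  rw [alphaOf, hv, Real.sqrt_eq_iff_mul_self_eq hpos.le hpos.le] at hα
  exact ⟨v, hv, by nlinarith⟩

/-- A subspace of dimension at least two not contained in `ker β` contains an orthogonal pair
`u, w` with `u` a unit vector in `ker β` and `β w = 1`. -/
theorem exists_orthogonal_pair {V : Type*} [AddCommGroup V] [Module ℝ V]
    [FiniteDimensional ℝ V] {B : V →ₗ[ℝ] V →ₗ[ℝ] ℝ} (hB : IsPosDefSymm B) {β : V →ₗ[ℝ] ℝ}
    {V' : Submodule ℝ V} (hdim : 1 < finrank ℝ V') (hker : ¬ V' ≤ LinearMap.ker β) :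
    ∃ u w : V', β u = 0 ∧ B u u = 1 ∧ β w = 1 ∧ B u w = 0 := by
  have hne : LinearMap.ker (β ∘ₗ V'.subtype) ≠ ⊥ :=
    LinearMap.ker_ne_bot_of_finrank_lt (by simpa using hdim)
  obtain ⟨u, hu, hu0⟩ := (Submodule.ne_bot_iff _).1 hne
  obtain ⟨w, hw, hw0⟩ := SetLike.not_le_iff_exists.1 hker
  simp only [LinearMap.mem_ker, LinearMap.comp_apply, Submodule.subtype_apply] at hu hw0
  have hpos : 0 < B u u := hB.2 u (by simpa using hu0)
  have hr := Real.mul_self_sqrt hpos.le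
  have hr0 := (Real.sqrt_pos.2 hpos).ne'
  refine ⟨(√(B u u))⁻¹ • u, (β w)⁻¹ • (⟨w, hw⟩ - (B u w / B u u) • u), ?_, ?_, ?_, ?_⟩
  · simp [hu]
  · simp only [Submodule.coe_smul, map_smul, LinearMap.smul_apply, smul_eq_mul]
    rw [← mul_assoc, ← mul_inv, hr, inv_mul_cancel₀ hpos.ne']
  · simp [hu, hw0]
  · simp [div_mul_cancel₀ _ hpos.ne']

/-- if a non-Euclidean `(α,β)`-norm `F` (dimension `> 2`) has a normalized
datum whose `φ` is smooth on `[-1,1]` and real analytic on `(-1,1)`, and `F` restricts to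
a Randers norm on a subspace `V'` of dimension `> 1` not contained in `ker β`, then `F` is
a Randers norm. -/
theorem statement15 {V : Type*} [NormedAddCommGroup V] [NormedSpace ℝ V]
    [FiniteDimensional ℝ V] (n : ℕ) (hn : 2 < n) (hdim : finrank ℝ V = n)
    (F : V → ℝ) (φ : ℝ → ℝ) (B : V →ₗ[ℝ] V →ₗ[ℝ] ℝ) (β : V →ₗ[ℝ] ℝ)
    (hMink : IsMinkowskiNorm F) (hnonE : ¬ IsEuclideanNorm F)
    (hdatum : IsNormalizedDatum F φ B β)
    (hφsmooth : ContDiffOn ℝ (⊤ : ℕ∞) φ (Set.Icc (-1 : ℝ) 1))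
    (hφanalytic : ∀ s ∈ Set.Ioo (-1 : ℝ) 1, AnalyticAt ℝ φ s)
    (V' : Submodule ℝ V) (m : ℕ) (hm : 1 < m) (hdimV' : finrank ℝ V' = m)
    (hnotker : ¬ V' ≤ LinearMap.ker β)
    (hrand : IsRandersNorm (fun y : V' => F y)) :
    IsRandersNorm F := by
  have hβ : β ≠ 0 := by
    rintro rfl
    exact hnotker (by simp)
  obtain ⟨v, hv, hβv⟩ := hdatum.exists_dual_vector hβ
  obtain ⟨⟨hB, -, -, hF⟩, hFker, -⟩ := hdatum
  obtain ⟨u, w, hu, huu, hw, huw⟩ := exists_orthogonal_pair hB (hdimV' ▸ hm) hnotker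
  obtain ⟨-, B', β', hB', -, hF'⟩ := hrand
  have hBv : B v v = 1 := by rw [hv, hβv]
  have hv0 : v ≠ 0 := by
    rintro rfl
    simp at hβv
  have hu0 : (u : V) ≠ 0 := by
    intro h
    simp [h] at huu
  have hφ0 : φ 0 = 1 := by
    have h₁ := hF u hu0
    rw [← hFker u hu] at h₁
    simpa [alphaOf, huu, hu] using h₁.symm
  have hφ1 : 0 < φ 1 := by
    simpa [alphaOf, hBv, hβv, hF v hv0] using hMink.pos v hv0
  have hφ1' : 0 < φ (-1) := by
    simpa [alphaOf, hBv, hβv, hF (-v) (neg_ne_zero.2 hv0)] using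
      hMink.pos (-v) (neg_ne_zero.2 hv0)
  have hwu : B w u = 0 := by rw [hB.1, huw]
  have hexp : ∀ a b : ℝ, B' (a • u + b • w) (a • u + b • w) =
      B' u u * a ^ 2 + 2 * B' u w * (a * b) + B' w w * b ^ 2 := by
    intro a b
    simp only [map_add, map_smul, LinearMap.add_apply, LinearMap.smul_apply, smul_eq_mul,
      hB'.1 w u]
    ring
  have hloc := exists_randers_profile_of_plane (φ := φ) (P := B' u u) (D := B' u w)
    (c := B w w) (E := B' w w) (p := β' u) (q := β' w) hφ0
    (fun a b _ => by
      rw [← hexp]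
      by_cases h : a • u + b • w = 0
      · simp [h]
      · exact (hB'.2 _ h).le)
    (fun a b hab => by
      have hBy : B ((a • u + b • w : V') : V) ((a • u + b • w : V') : V) = 1 := by
        simp only [Submodule.coe_add, Submodule.coe_smul, map_add, map_smul,
          LinearMap.add_apply, LinearMap.smul_apply, smul_eq_mul, huu, huw, hwu]
        linarith
      have hβy : β ((a • u + b • w : V') : V) = b := by simp [hu, hw]
      have hy0 : ((a • u + b • w : V') : V) ≠ 0 := by
        intro h
        simp [h] at hBy
      have h₁ := hF' (a • u + b • w)
      simp only [hF _ hy0, alphaOf, hBy, hβy, hexp] at h₁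
      simpa [mul_comm] using h₁)
  set q := β' w
  set k := B' w w - B w w
  obtain ⟨hk, hφ⟩ := eqOn_randers_profile hφsmooth.continuousOn hφanalytic hloc hφ1 hφ1'
  have hcs : ∀ y, β y ^ 2 ≤ B y y := by
    intro y
    have hz : B (y - β y • v) (y - β y • v) = B y y - β y ^ 2 := by
      simp only [map_sub, map_smul, LinearMap.sub_apply, LinearMap.smul_apply, smul_eq_mul,
        hB.1 y v, hv, hβv]
      ring
    by_cases h : y - β y • v = 0
    · simp only [h, map_zero] at hz
      linarith
    · linarith [hB.2 _ h]
  let C : V →ₗ[ℝ] V →ₗ[ℝ] ℝ := B + k • (LinearMap.mul ℝ ℝ).compl₁₂ β β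
  have hC : ∀ x y, C x y = B x y + k * (β x * β y) := fun x y => by simp [C]
  have hCpos : ∀ x, x ≠ 0 → 0 < C x x := by
    intro x hx
    rw [hC]
    have := hB.2 x hx
    rcases le_or_gt 0 k with h | h
    · nlinarith [mul_nonneg h (mul_self_nonneg (β x))]
    · nlinarith [mul_nonneg (neg_nonneg.2 h.le) (sub_nonneg.2 (hcs x)),
        mul_pos (show 0 < 1 + k by linarith) this]
  have hFC : ∀ y, F y = alphaOf C y + (q • β) y := by
    intro y
    by_cases hy : y = 0
    · subst hy
      have := hMink.homog 2 two_pos 0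
      rw [smul_zero] at this
      simp only [alphaOf, map_zero, Real.sqrt_zero, add_zero]
      linarith
    have hBy := hB.2 y hy
    have hα : 0 < alphaOf B y := Real.sqrt_pos.2 hBy
    have hα2 : alphaOf B y ^ 2 = B y y := Real.sq_sqrt hBy.le
    have habs : |β y| ≤ alphaOf B y := Real.abs_le_sqrt (hcs y)
    obtain ⟨hl, hr⟩ := abs_le.1 habs
    have hmem : β y / alphaOf B y ∈ Set.Icc (-1 : ℝ) 1 :=
      ⟨by rw [le_div_iff₀ hα]; linarith, by rw [div_le_iff₀ hα]; linarith⟩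
    rw [hF y hy, hφ _ hmem, mul_add]
    congr 1
    · conv_rhs => rw [alphaOf]
      have hCy : C y y = alphaOf B y ^ 2 * (1 + k * (β y / alphaOf B y) ^ 2) := by
        rw [hC, ← hα2]
        field_simp
      rw [hCy, Real.sqrt_mul (sq_nonneg _), Real.sqrt_sq hα.le]
    · rw [LinearMap.smul_apply, smul_eq_mul]
      field_simp
  refine ⟨hMink, C, q • β, ⟨fun x y => ?_, hCpos⟩, fun y hy => ?_, hFC⟩
  · rw [hC, hC, hB.1 x y, mul_comm (β x)]
  · have h₁ := hMink.pos y hy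
    have h₂ := hMink.pos (-y) (neg_ne_zero.2 hy)
    have hα : alphaOf C (-y) = alphaOf C y := by simp [alphaOf]
    rw [hFC] at h₁ h₂
    rw [hα, map_neg] at h₂
    exact abs_lt.2 ⟨by linarith, by linarith⟩
end
end

section
/- Let V be a finite-dimensional real vector space with dim V ≥ 2, α the norm of an inner product on V, β a nonzero linear form on V with ‖β‖_α ≤ 1, and φ a positive smooth function on [−‖β‖_α, ‖β‖_α] such that F = α·φ(β/α) is a Minkowski norm on V. If F is a Randers norm, then there exist real constants k₁, k₂, k₃ and ε > 0 such that φ(s) = √(k₁ + k₂s²) + k₃·s for all s with |s| < ε. -/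
noncomputable section

open Module Topology

/-- A linear form on a space of dimension at least two has a nonzero kernel vector, and a
vector orthogonal to it on which the form does not vanish. -/
theorem exists_orthogonal_pair_s16 {V : Type*} [NormedAddCommGroup V] [NormedSpace ℝ V]
    [FiniteDimensional ℝ V] (hdim : 2 ≤ finrank ℝ V)
    {B : V →ₗ[ℝ] V →ₗ[ℝ] ℝ} (hB : IsPosDefSymm B) {β : V →ₗ[ℝ] ℝ} (hβ : β ≠ 0) :
    ∃ e g : V, g ≠ 0 ∧ β g = 0 ∧ β e ≠ 0 ∧ B e g = 0 := by
  have hker : LinearMap.ker β ≠ ⊥ :=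
    LinearMap.ker_ne_bot_of_finrank_lt (by rw [finrank_self]; omega)
  obtain ⟨g, hg, hg0⟩ := (Submodule.ne_bot_iff _).1 hker
  obtain ⟨v, hv⟩ : ∃ v, β v ≠ 0 := by
    by_contra! h
    exact hβ (LinearMap.ext h)
  have hβg : β g = 0 := hg
  have hgg : B g g ≠ 0 := (hB.2 g hg0).ne'
  refine ⟨v - (B v g / B g g) • g, g, hg0, hβg, by simpa [hβg] using hv, ?_⟩
  simp [hgg]

/-- Expansion of a symmetric form on a combination of two orthogonal vectors. -/
theorem apply_combination_of_orthogonal {V : Type*} [AddCommGroup V] [Module ℝ V]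
    {B : V →ₗ[ℝ] V →ₗ[ℝ] ℝ} (hB : IsPosDefSymm B) {e g : V} (h : B e g = 0) (x t : ℝ) :
    B (x • e + t • g) (x • e + t • g) = x ^ 2 * B e e + t ^ 2 * B g g := by
  have h' : B g e = 0 := by rw [hB.1, h]
  simp [h, h']
  ring

/-- if `F = α·φ(β/α)` is a Minkowski norm (with `β ≠ 0`, `‖β‖_α = r ≤ 1`,
`φ` positive and smooth on `[-r, r]`) which is a Randers norm, then
`φ(s) = √(k₁ + k₂s²) + k₃s` near `s = 0`. -/
theorem statement16 {V : Type*} [NormedAddCommGroup V] [NormedSpace ℝ V]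
    [FiniteDimensional ℝ V] (hdim : 2 ≤ finrank ℝ V)
    (B : V →ₗ[ℝ] V →ₗ[ℝ] ℝ) (hB : IsPosDefSymm B)
    (β : V →ₗ[ℝ] ℝ) (hβ : β ≠ 0)
    (r : ℝ) (hr1 : ∀ y : V, |β y| ≤ r * alphaOf B y)
    (hr2 : ∃ y : V, y ≠ 0 ∧ |β y| = r * alphaOf B y)
    (hr3 : r ≤ 1)
    (φ : ℝ → ℝ) (hφpos : ∀ s ∈ Set.Icc (-r) r, 0 < φ s)
    (hφsmooth : ContDiffOn ℝ (⊤ : ℕ∞) φ (Set.Icc (-r) r))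
    (F : V → ℝ) (hF0 : F 0 = 0)
    (hFy : ∀ y : V, y ≠ 0 → F y = alphaOf B y * φ (β y / alphaOf B y))
    (hMink : IsMinkowskiNorm F)
    (hRanders : IsRandersNorm F) :
    ∃ k₁ k₂ k₃ ε : ℝ, 0 < ε ∧
      ∀ s : ℝ, |s| < ε → φ s = Real.sqrt (k₁ + k₂ * s ^ 2) + k₃ * s := by
  obtain ⟨e, g, hg0, hβg, hβe, heg⟩ := exists_orthogonal_pair_s16 hdim hB hβ
  obtain ⟨-, B', β', hB', -, hF⟩ := hRanders
  have hgg : 0 < B g g := hB.2 g hg0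
  have he0 : e ≠ 0 := by
    rintro rfl
    simp at hβe
  have hee : 0 < B e e := hB.2 e he0
  have hβ'g : β' g = 0 := by
    have h : F g = F (-g) := by
      rw [hFy g hg0, hFy (-g) (neg_ne_zero.2 hg0)]
      simp [alphaOf, hβg]
    rw [hF, hF] at h
    simp only [alphaOf, map_neg, LinearMap.neg_apply, neg_neg] at h
    linarith
  have hB'eg : B' e g = 0 := by
    have hadd := apply_combination_of_orthogonal hB heg 1 1
    have hsub := apply_combination_of_orthogonal hB heg 1 (-1)
    simp only [one_smul, neg_smul] at hadd hsub
    have hne : e + g ≠ 0 := fun h => hβe (by simpa [hβg] using congrArg β h)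
    have hne' : e + -g ≠ 0 := fun h => hβe (by simpa [hβg] using congrArg β h)
    have h : F (e + g) = F (e + -g) := by
      rw [hFy _ hne, hFy _ hne']
      simp only [alphaOf, hadd, hsub]
      simp [hβg]
    rw [hF, hF, alphaOf, alphaOf] at h
    simp only [map_add β', map_neg β', hβ'g, neg_zero, add_left_inj] at h
    rw [Real.sqrt_inj (hB'.2 _ hne).le (hB'.2 _ hne').le] at h
    have hsymm := hB'.1 g e
    simp only [map_add, map_neg, LinearMap.add_apply, LinearMap.neg_apply] at h
    linarith
  refine ⟨B' g g / B g g, (B' e e - B e e * (B' g g / B g g)) / β e ^ 2, β' e / β e,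
    |β e| / √(B e e), by positivity, fun s hs => ?_⟩
  have hx : (s / β e) ^ 2 * B e e ≤ 1 := by
    rw [lt_div_iff₀ (by positivity)] at hs
    have h := pow_le_pow_left₀ (by positivity) hs.le 2
    rw [mul_pow, Real.sq_sqrt hee.le, sq_abs, sq_abs] at h
    rw [div_pow, div_mul_eq_mul_div, div_le_one (by positivity)]
    exact h
  set x := s / β e with hxdef
  have ht : √((1 - x ^ 2 * B e e) / B g g) ^ 2 = (1 - x ^ 2 * B e e) / B g g :=
    Real.sq_sqrt (div_nonneg (by linarith) hgg.le)
  set t := √((1 - x ^ 2 * B e e) / B g g)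
  have hBy := apply_combination_of_orthogonal hB heg x t
  have hB'y := apply_combination_of_orthogonal hB' hB'eg x t
  rw [ht, div_mul_cancel₀ _ hgg.ne', add_sub_cancel] at hBy
  have hy : x • e + t • g ≠ 0 := by
    intro h
    simp [h] at hBy
  have h := hFy _ hy
  have hβy : β (x • e + t • g) = s := by
    simp [hβg, hxdef, hβe]
  have hβ'y : β' (x • e + t • g) = β' e / β e * s := by
    simp [hβ'g, hxdef]
    ring
  rw [hF, alphaOf, alphaOf, hBy, hβy, hβ'y, hB'y, ht] at h
  rw [Real.sqrt_one, one_mul, div_one] at h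
  rw [← h]
  congr 2
  rw [hxdef]
  field_simp
  ring
end
end

section
/- Let V be a finite-dimensional real vector space, q : V → ℝ a quadratic form (i.e. q(x) = B(x,x) for a symmetric bilinear form B), and ℓ a nonzero linear form on V. If q(x) = 0 for every x ∈ ker ℓ, then there exists a linear form m on V such that q(x) = ℓ(x)·m(x) for all x ∈ V. -/
/-- if a quadratic form `q` vanishes on the kernel of a nonzero linear form
`ℓ`, then `q = ℓ·m` for some linear form `m`. -/
theorem statement17 {V : Type*} [AddCommGroup V] [Module ℝ V] [FiniteDimensional ℝ V]
    (B : V →ₗ[ℝ] V →ₗ[ℝ] ℝ) (hB : ∀ x y, B x y = B y x)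
    (q : V → ℝ) (hq : ∀ x, q x = B x x)
    (ℓ : V →ₗ[ℝ] ℝ) (hℓ : ℓ ≠ 0)
    (h : ∀ x, ℓ x = 0 → q x = 0) :
    ∃ m : V →ₗ[ℝ] ℝ, ∀ x, q x = ℓ x * m x := by
  obtain ⟨v, hv⟩ : ∃ v, ℓ v ≠ 0 := by
    by_contra! H
    exact hℓ (LinearMap.ext H)
  obtain ⟨e, he⟩ : ∃ e, ℓ e = 1 := ⟨(ℓ v)⁻¹ • v, by simp [hv]⟩
  refine ⟨(2 : ℝ) • B e - B e e • ℓ, fun x => ?_⟩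
  have hx := h (x - ℓ x • e) (by simp [he])
  simp only [hq, map_sub, map_smul, LinearMap.sub_apply, LinearMap.smul_apply, smul_eq_mul,
    hB x e] at hx ⊢
  linear_combination hx
end

section
/- Let 𝔤 be a compact simple Lie algebra and let l : 𝔤 → 𝔤 be a linear map such that l(𝔱) ⊆ 𝔱 for every Cartan subalgebra 𝔱 of 𝔤. Then l is a scalar multiple of the identity map. -/
section CompactLie

variable {g : Type*} [LieRing g] [LieAlgebra ℝ g]

/-- The Killing form is skew with respect to the adjoint action. -/
lemma killingForm_lie_left (x y z : g) :
    killingForm ℝ g ⁅x, y⁆ z = -killingForm ℝ g y ⁅x, z⁆ := by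
  rw [← lie_skew, map_neg, LinearMap.neg_apply, LieModule.traceForm_apply_lie_apply]

/-- In a Lie algebra with definite Killing form, `ad x` is semisimple at zero. -/
lemma lie_eq_zero_of_lie_lie_eq_zero (hcompact : ∀ X : g, X ≠ 0 → killingForm ℝ g X X < 0)
    {x y : g} (h : ⁅x, ⁅x, y⁆⁆ = 0) : ⁅x, y⁆ = 0 := by
  by_contra hne
  have := hcompact _ hne
  rw [killingForm_lie_left, h] at this
  simp at this

/-- An element commuting with everything vanishes when the Killing form is definite. -/
lemma eq_zero_of_forall_lie_eq_zero (hcompact : ∀ X : g, X ≠ 0 → killingForm ℝ g X X < 0)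
    {d : g} (h : ∀ x : g, ⁅x, d⁆ = 0) : d = 0 := by
  by_contra hne
  have h0 : LieAlgebra.ad ℝ g d = 0 := by
    ext y
    rw [LieAlgebra.ad_apply, ← lie_skew, h y]
    simp
  have := hcompact d hne
  rw [killingForm_apply_apply, h0] at this
  simp at this

/-- A maximal commuting subspace is a Cartan subalgebra when the Killing form is definite;
in particular every element lies in an abelian Cartan subalgebra. -/
lemma exists_isCartanSubalgebra_mem [Module.Finite ℝ g]
    (hcompact : ∀ X : g, X ≠ 0 → killingForm ℝ g X X < 0) (x : g) :
    ∃ t : LieSubalgebra ℝ g, t.IsCartanSubalgebra ∧ x ∈ t ∧ ∀ a ∈ t, ∀ b ∈ t, ⁅a, b⁆ = 0 := by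
  let S : Set (Submodule ℝ g) := {t | x ∈ t ∧ ∀ a ∈ t, ∀ b ∈ t, ⁅a, b⁆ = 0}
  have hS : S.Nonempty := by
    refine ⟨Submodule.span ℝ {x}, Submodule.mem_span_singleton_self x, ?_⟩
    intro a ha b hb
    obtain ⟨r, rfl⟩ := Submodule.mem_span_singleton.1 ha
    obtain ⟨s, rfl⟩ := Submodule.mem_span_singleton.1 hb
    simp
  obtain ⟨t, ⟨hxt, hab⟩, hmax⟩ := (wellFounded_gt (α := Submodule ℝ g)).has_min S hS
  have hcent : ∀ y : g, (∀ a ∈ t, ⁅a, y⁆ = 0) → y ∈ t := by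
    intro y hy
    have hy' : ∀ a ∈ t, ⁅y, a⁆ = 0 := fun a ha => by rw [← lie_skew, hy a ha, neg_zero]
    by_contra hyt
    refine hmax (t ⊔ Submodule.span ℝ {y}) ⟨Submodule.mem_sup_left hxt, ?_⟩ ?_
    · intro a ha b hb
      obtain ⟨a, hat, a', ha', rfl⟩ := Submodule.mem_sup.1 ha
      obtain ⟨b, hbt, b', hb', rfl⟩ := Submodule.mem_sup.1 hb
      obtain ⟨r, rfl⟩ := Submodule.mem_span_singleton.1 ha'
      obtain ⟨s, rfl⟩ := Submodule.mem_span_singleton.1 hb'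
      simp [hab a hat b hbt, hy a hat, hy' b hbt]
    · refine lt_of_le_of_ne le_sup_left fun heq => hyt ?_
      rw [heq]
      exact Submodule.mem_sup_right (Submodule.mem_span_singleton_self y)
  let T : LieSubalgebra ℝ g :=
    { t with lie_mem' := fun {a b} ha hb => (hab a ha b hb).symm ▸ t.zero_mem }
  have habT : ∀ a ∈ T, ∀ b ∈ T, ⁅a, b⁆ = 0 := hab
  refine ⟨T, ⟨?_, ?_⟩, hxt, habT⟩
  · have : IsLieAbelian T := ⟨fun a b => Subtype.ext (habT a a.2 b b.2)⟩
    infer_instance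
  · refine le_antisymm (fun y hy => ?_) T.le_normalizer
    rw [LieSubalgebra.mem_normalizer_iff] at hy
    refine hcent y fun a ha => lie_eq_zero_of_lie_lie_eq_zero hcompact ?_
    rw [← lie_skew a y, lie_neg, habT a ha _ (hy a ha), neg_zero]

/-- A linear map with `⁅f x, y⁆ = ⁅x, f y⁆` on a Lie algebra with definite Killing form
lies in the centroid. -/
lemma map_lie_eq_lie_map_of_lie_map_eq (hcompact : ∀ X : g, X ≠ 0 → killingForm ℝ g X X < 0)
    (f : g →ₗ[ℝ] g) (hf : ∀ x y : g, ⁅f x, y⁆ = ⁅x, f y⁆) (x y : g) :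
    f ⁅x, y⁆ = ⁅x, f y⁆ := by
  let δ : g → g → g := fun x y => f ⁅x, y⁆ - ⁅x, f y⁆
  have hδ : ∀ x y, δ x y = f ⁅x, y⁆ - ⁅x, f y⁆ := fun _ _ => rfl
  have hanti : ∀ x y, δ x y = -δ y x := by
    intro x y
    rw [hδ, hδ, ← lie_skew x y, map_neg, ← hf x y, ← lie_skew (f x) y]
    abel
  have hcomb : ∀ x y z : g, (2 : ℝ) • ⁅z, δ x y⁆ = ⁅x, δ y z⁆ + ⁅y, δ z x⁆ := by
    intro x y z
    have h1 : ⁅z, f ⁅x, y⁆⁆ = ⁅⁅f z, x⁆, y⁆ + ⁅x, ⁅f z, y⁆⁆ := by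
      rw [← hf, leibniz_lie]
    have h2 : ⁅z, ⁅x, f y⁆⁆ = ⁅⁅z, x⁆, f y⁆ + ⁅x, ⁅z, f y⁆⁆ := leibniz_lie _ _ _
    have h3 : ⁅⁅z, x⁆, f y⁆ = -⁅y, f ⁅z, x⁆⁆ := by rw [← hf, lie_skew]
    have h4 : ⁅⁅f z, x⁆, y⁆ = -⁅y, ⁅z, f x⁆⁆ := by rw [hf, lie_skew]
    have h5 : ⁅x, f ⁅y, z⁆⁆ = -⁅x, f ⁅z, y⁆⁆ := by
      rw [← lie_skew y z, map_neg, lie_neg]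
    have h6 : ⁅x, ⁅y, f z⁆⁆ = -⁅x, ⁅f z, y⁆⁆ := by rw [← lie_skew y, lie_neg]
    have h7 : ⁅x, f ⁅z, y⁆⁆ = ⁅⁅f x, z⁆, y⁆ + ⁅z, ⁅f x, y⁆⁆ := by rw [← hf, leibniz_lie]
    have h8 : ⁅⁅f x, z⁆, y⁆ = ⁅y, ⁅z, f x⁆⁆ := by
      rw [← lie_skew _ y, ← lie_skew _ z, lie_neg, neg_neg]
    have h9 : ⁅z, ⁅f x, y⁆⁆ = ⁅z, ⁅x, f y⁆⁆ := by rw [hf]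
    have h10 : ⁅x, ⁅f z, y⁆⁆ = ⁅x, ⁅z, f y⁆⁆ := by rw [hf]
    simp only [hδ, lie_sub]
    rw [h5, h6, h7, h8, h9, h10, h1, h4, h10, two_smul]
    rw [h3] at h2
    have h11 : ⁅y, f ⁅z, x⁆⁆ = ⁅x, ⁅z, f y⁆⁆ - ⁅z, ⁅x, f y⁆⁆ := by rw [h2]; abel
    rw [h11]
    abel
  have hcyc : ∀ x y z : g, ⁅z, δ x y⁆ = ⁅x, δ y z⁆ := by
    intro x y z
    have e1 := hcomb x y z
    have e2 := hcomb y z x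
    have h3 : (3 : ℝ) • (⁅z, δ x y⁆ - ⁅x, δ y z⁆) = 0 := by
      have : (3 : ℝ) • (⁅z, δ x y⁆ - ⁅x, δ y z⁆) =
          ((2 : ℝ) • ⁅z, δ x y⁆ - (2 : ℝ) • ⁅x, δ y z⁆) + (⁅z, δ x y⁆ - ⁅x, δ y z⁆) := by
        module
      rw [this, e1, e2]
      abel
    exact sub_eq_zero.1 ((smul_eq_zero.1 h3).resolve_left (by norm_num))
  have hsym : ∀ x y z w : g, killingForm ℝ g ⁅x, f y⁆ ⁅z, w⁆ = killingForm ℝ g ⁅x, y⁆ (f ⁅z, w⁆) := by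
    intro x y z w
    rw [← hf, killingForm_lie_left, killingForm_lie_left, hf]
  let F : g → g → g → g → ℝ := fun x y z w => killingForm ℝ g ⁅x, δ y z⁆ w
  have hF1 : ∀ x y z w, F x y z w = -F x z y w := by
    intro x y z w
    simp only [F]
    rw [hanti y z, lie_neg, map_neg, LinearMap.neg_apply]
  have hF2 : ∀ x y z w, F x y z w = F y z x w := by
    intro x y z w
    simp only [F]
    rw [hcyc y z x]
  have hF3 : ∀ x y z w, F x y z w = -F w y z x := by
    intro x y z w
    simp only [F]
    rw [killingForm_lie_left, killingForm_lie_left, ← lie_skew x w, map_neg]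
  have hF4 : ∀ x y z w, F x y z w = -F y x w z := by
    intro x y z w
    have key : ∀ x y z w, F x y z w =
        killingForm ℝ g ⁅y, z⁆ (f ⁅x, w⁆) - killingForm ℝ g (f ⁅y, z⁆) ⁅x, w⁆ := by
      intro x y z w
      simp only [F]
      rw [killingForm_lie_left, hδ, map_sub, LinearMap.sub_apply, hsym]
      abel
    rw [key, key, LieModule.traceForm_comm ℝ g g (f ⁅y, z⁆),
      LieModule.traceForm_comm ℝ g g (f ⁅x, w⁆)]
    abel
  have hF0 : ∀ x y z w, F x y z w = 0 := by
    intro x y z w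
    have s12 : ∀ a b c d, F a b c d = -F b a c d := fun a b c d => by rw [hF2, hF1]
    have s13 : ∀ a b c d, F a b c d = -F c b a d := fun a b c d => by rw [hF2, s12]
    have s34 : ∀ a b c d, F a b c d = -F a b d c := fun a b c d => by
      rw [s13 a b c d, hF3 c b a d, s13 d b a c, neg_neg]
    have e1 := hF4 x y z w
    rw [s12 y x] at e1
    linarith [s34 x y z w]
  have hzero : δ x y = 0 := by
    refine eq_zero_of_forall_lie_eq_zero hcompact fun z => ?_
    by_contra hne
    exact (hcompact _ hne).ne (hF0 z x y _)
  exact sub_eq_zero.1 hzero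

/-- A centroid element is self-adjoint with respect to the Killing form. -/
lemma killingForm_map_left_of_map_lie (f : g →ₗ[ℝ] g) (hf : ∀ x y : g, ⁅f x, y⁆ = ⁅x, f y⁆)
    (hf' : ∀ x y : g, f ⁅x, y⁆ = ⁅x, f y⁆) (x y : g) :
    killingForm ℝ g (f x) y = killingForm ℝ g x (f y) := by
  rw [killingForm_apply_apply, killingForm_apply_apply]
  congr 1
  ext z
  simp [hf, hf']

end CompactLie

/-- A linear map that is self-adjoint for a symmetric positive definite form on a nontrivial
finite-dimensional real vector space has an eigenvector. -/
lemma exists_eigenvector_of_posDef {V : Type*} [AddCommGroup V] [Module ℝ V]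
    [Module.Finite ℝ V] [Nontrivial V] (B : LinearMap.BilinForm ℝ V)
    (hB : ∀ x y, B x y = B y x) (hpos : ∀ x, x ≠ 0 → 0 < B x x)
    (f : V →ₗ[ℝ] V) (hf : ∀ x y, B (f x) y = B x (f y)) :
    ∃ c : ℝ, ∃ v : V, v ≠ 0 ∧ f v = c • v := by
  let core : InnerProductSpace.Core ℝ V :=
    { inner := fun x y => B x y
      conj_inner_symm := fun x y => by simp [hB y x]
      re_inner_nonneg := fun x => by
        by_cases hx : x = 0
        · simp [hx]
        · simpa using (hpos x hx).le
      add_left := fun x y z => by simp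
      smul_left := fun x y r => by simp
      definite := fun x hx => by
        by_contra hne
        exact (hpos x hne).ne' hx }
  let : NormedAddCommGroup V := core.toNormedAddCommGroup
  let : InnerProductSpace ℝ V := InnerProductSpace.ofCore core.toCore
  have hsym : LinearMap.IsSymmetric f := hf
  have hev := hsym.hasEigenvalue_iSup_of_finiteDimensional
  obtain ⟨v, hv⟩ := hev.exists_hasEigenvector
  exact ⟨_, v, hv.2, hv.apply_eq_smul⟩

/-- a linear map of a compact simple Lie algebra preserving every Cartan
subalgebra is a scalar multiple of the identity. -/
theorem statement18 {g : Type*} [LieRing g] [LieAlgebra ℝ g] [Module.Finite ℝ g]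
    (hsimple : LieAlgebra.IsSimple ℝ g)
    (hcompact : ∀ X : g, X ≠ 0 → killingForm ℝ g X X < 0)
    (l : g →ₗ[ℝ] g)
    (hl : ∀ t : LieSubalgebra ℝ g, t.IsCartanSubalgebra → ∀ x ∈ t, l x ∈ t) :
    ∃ c : ℝ, ∀ x : g, l x = c • x := by
  have hcomm : ∀ x, ⁅x, l x⁆ = 0 := by
    intro x
    obtain ⟨t, ht, hx, hab⟩ := exists_isCartanSubalgebra_mem hcompact x
    exact hab x hx _ (hl t ht x hx)
  have hq : ∀ x y, ⁅l x, y⁆ = ⁅x, l y⁆ := by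
    intro x y
    have h := hcomm (x + y)
    simp only [map_add, add_lie, lie_add, hcomm, zero_add, add_zero] at h
    rw [← lie_skew, neg_eq_iff_add_eq_zero, add_comm]
    simpa [add_comm] using h
  have hcen := map_lie_eq_lie_map_of_lie_map_eq hcompact l hq
  have : Nontrivial g := by
    by_contra hn
    rw [not_nontrivial_iff_subsingleton] at hn
    exact hsimple.non_abelian ⟨fun _ _ => Subsingleton.elim _ _⟩
  obtain ⟨c, v, hv, hcv⟩ := exists_eigenvector_of_posDef (-killingForm ℝ g)
    (fun x y => by simp [LieModule.traceForm_comm ℝ g g x y])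
    (fun x hx => by simpa using hcompact x hx) l
    (fun x y => by simp [killingForm_map_left_of_map_lie l hq hcen x y])
  let I : LieIdeal ℝ g :=
    { LinearMap.ker (l - c • LinearMap.id) with
      lie_mem := fun {x m} hm => by
        have hm' : l m = c • m := by simpa [sub_eq_zero] using hm
        simp [hcen, hm'] }
  have hmem : ∀ x, x ∈ I ↔ l x = c • x := fun x => by
    change x ∈ LinearMap.ker (l - c • LinearMap.id) ↔ _
    simp [sub_eq_zero]
  refine ⟨c, fun x => (hmem x).1 ?_⟩
  rcases hsimple.eq_bot_or_eq_top I with h | h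
  · exact absurd ((LieSubmodule.mem_bot v).1 (h ▸ (hmem v).2 hcv)) hv
  · rw [h]
    exact LieSubmodule.mem_top x
end

section
/- Let V be a nonzero finite-dimensional real vector space, l : V → V a linear map, and S ⊆ V ∖ {0} a connected subset (in the subspace topology) whose linear span is all of V, such that every s ∈ S is an eigenvector of l (i.e. l(s) ∈ ℝ·s). Then l is a scalar multiple of the identity map. -/
/-- A preconnected set of eigenvectors of an endomorphism of a finite-dimensional real space lies
in a single eigenspace. -/
theorem IsPreconnected.subset_eigenspace {V : Type*} [NormedAddCommGroup V] [NormedSpace ℝ V]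
    [FiniteDimensional ℝ V] {l : Module.End ℝ V} {S : Set V} (hS : IsPreconnected S)
    (heig : ∀ s ∈ S, ∃ c : ℝ, l.HasEigenvector c s) {c : ℝ} {s₀ : V} (hs₀ : s₀ ∈ S)
    (hc : l.HasEigenvector c s₀) : S ⊆ l.eigenspace c := by
  intro s hs
  obtain ⟨d, hd⟩ := heig s hs
  by_contra hsc
  have hfin : ({μ | l.HasEigenvalue μ} \ {c}).Finite :=
    (Module.End.finite_hasEigenvalue l).subset Set.sdiff_subset
  have hdc : d ≠ c := fun h ↦ hsc (h ▸ hd.1)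
  obtain ⟨x, hxS, hxc, hx⟩ := isPreconnected_closed_iff.1 hS (l.eigenspace c)
    (⋃ μ ∈ {μ | l.HasEigenvalue μ} \ {c}, (l.eigenspace μ : Set V))
    (l.eigenspace c).closed_of_finiteDimensional
    (hfin.isClosed_biUnion fun μ _ ↦ (l.eigenspace μ).closed_of_finiteDimensional)
    (fun x hx ↦ by
      obtain ⟨μ, hμ⟩ := heig x hx
      by_cases h : μ = c
      · exact Or.inl (h ▸ hμ.1)
      · exact Or.inr (Set.mem_biUnion (x := μ)
          ⟨Module.End.hasEigenvalue_of_hasEigenvector hμ, h⟩ hμ.1))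
    ⟨s₀, hs₀, hc.1⟩
    ⟨s, hs, Set.mem_biUnion (x := d)
      ⟨Module.End.hasEigenvalue_of_hasEigenvector hd, hdc⟩ hd.1⟩
  obtain ⟨μ, ⟨-, hμc⟩, hxμ⟩ := Set.mem_iUnion₂.1 hx
  obtain ⟨ν, hν⟩ := heig x hxS
  have h : c • x = μ • x :=
    (Module.End.mem_eigenspace_iff.1 hxc).symm.trans (Module.End.mem_eigenspace_iff.1 hxμ)
  exact hμc (smul_left_injective ℝ hν.2 h).symm

/-- if a connected set `S ⊆ V ∖ {0}` spans `V` and consists of eigenvectors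
of the linear map `l`, then `l` is a scalar multiple of the identity. -/
theorem statement19 {V : Type*} [NormedAddCommGroup V] [NormedSpace ℝ V]
    [FiniteDimensional ℝ V] [Nontrivial V]
    (l : V →ₗ[ℝ] V) (S : Set V) (hS0 : (0 : V) ∉ S)
    (hconn : IsConnected S) (hspan : Submodule.span ℝ S = ⊤)
    (heig : ∀ s ∈ S, ∃ c : ℝ, l s = c • s) :
    ∃ c : ℝ, ∀ x : V, l x = c • x := by
  have heig' : ∀ s ∈ S, ∃ c : ℝ, Module.End.HasEigenvector l c s := fun s hs ↦
    (heig s hs).imp fun c hc ↦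
      ⟨Module.End.mem_eigenspace_iff.2 hc, ne_of_mem_of_not_mem hs hS0⟩
  obtain ⟨s₀, hs₀⟩ := hconn.nonempty
  obtain ⟨c, hc⟩ := heig' s₀ hs₀
  have htop : (⊤ : Submodule ℝ V) ≤ Module.End.eigenspace l c :=
    hspan ▸ Submodule.span_le.2 (hconn.isPreconnected.subset_eigenspace heig' hs₀ hc)
  exact ⟨c, fun x ↦ Module.End.mem_eigenspace_iff.1 (htop Submodule.mem_top)⟩
end
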